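/- arXiv:1906.09729 — 3 statements merged into one kernel-verified Lean document; each statement's English description precedes it below -/
import Mathlib

section
/- Let L be an integrable real random variable with E[L] = 0 whose distribution function F satisfies 1−F ∈ RV_{−η} for some η > 1 (Fréchet maximum domain of attraction MDA(Φ_η)). Then, as α ↗ 1: (i) (1−β*)/(1−α) → η − 1, where β* = P[L ≤ e_α(L)]; and (ii) e_α(L)/ES_α(L) → (η−1)^{(η−1)/η}/η. -/
open MeasureTheory Filter Topology Real Set
open scoped ENNReal

/-- Left-quantile function: `q_L(u) = inf {m : P[L ≤ m] ≥ u}`. -/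
noncomputable def leftQuantile {Ω : Type*} [MeasurableSpace Ω] (P : Measure Ω)
    (L : Ω → ℝ) (u : ℝ) : ℝ :=
  sInf {m : ℝ | u ≤ (P {ω | L ω ≤ m}).toReal}

/-- Expected shortfall: `ES_α(L) = (1/(1-α)) ∫_α^1 q_L(u) du`. -/
noncomputable def ES {Ω : Type*} [MeasurableSpace Ω] (P : Measure Ω)
    (L : Ω → ℝ) (α : ℝ) : ℝ :=
  (1 - α)⁻¹ * ∫ u in α..1, leftQuantile P L u

/-- The α-expectile is the (unique) `e` with `α E[(L-e)⁺] = (1-α) E[(L-e)⁻]`. -/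
def IsExpectile {Ω : Type*} [MeasurableSpace Ω] (P : Measure Ω)
    (L : Ω → ℝ) (α e : ℝ) : Prop :=
  α * ∫ ω, max (L ω - e) 0 ∂P = (1 - α) * ∫ ω, max (e - L ω) 0 ∂P

/-- Loss function `ℓ_{a,b}(x) = x⁺/a - b x⁻`. -/
noncomputable def lossFn (a b x : ℝ) : ℝ := max x 0 / a - b * max (-x) 0

/-- Optimized certainty equivalent `R_{a,b}(L) = inf { m + E[ℓ_{a,b}(L-m)] }`. -/
noncomputable def OCE {Ω : Type*} [MeasurableSpace Ω] (P : Measure Ω)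
    (L : Ω → ℝ) (a b : ℝ) : ℝ :=
  sInf {r : ℝ | ∃ m : ℝ, r = m + ∫ ω, lossFn a b (L ω - m) ∂P}

/-- `g` is regularly varying at infinity with index `ρ`. -/
def RegularlyVarying (g : ℝ → ℝ) (ρ : ℝ) : Prop :=
  ∀ x : ℝ, 0 < x → Tendsto (fun t => g (t * x) / g t) atTop (𝓝 (x ^ ρ))

/-- `g` is of second-order regular variation with indices `-η`, `ρ` and auxiliary function `A`. -/
def SecondOrderRV (g : ℝ → ℝ) (η ρ : ℝ) (A : ℝ → ℝ) : Prop :=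
  RegularlyVarying g (-η) ∧
  Tendsto A atTop (𝓝 0) ∧
  ((∀ᶠ t in atTop, 0 < A t) ∨ (∀ᶠ t in atTop, A t < 0)) ∧
  ∀ x : ℝ, 0 < x →
    Tendsto (fun t => (g (t * x) / g t - x ^ (-η)) / A t) atTop
      (𝓝 (if ρ = 0 then x ^ (-η) * Real.log x else x ^ (-η) * (x ^ ρ - 1) / ρ))

/-- Empirical measure `(1/n) ∑_{k<n} δ_{L_k(ω)}` of the first `n` samples. -/
noncomputable def empMeasure {Ω : Type*} [MeasurableSpace Ω] (L : ℕ → Ω → ℝ)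
    (n : ℕ) (ω : Ω) : Measure ℝ :=
  (n : ℝ≥0∞)⁻¹ • ∑ k ∈ Finset.range n, Measure.dirac (L k ω)


namespace FFO

lemma shift_integral (f : ℝ → ℝ) (x : ℝ) :
    ∫ t in Ioi (0 : ℝ), f (x + t) = ∫ t in Ioi x, f t := by
  have h := (measurePreserving_add_left (volume : Measure ℝ) x).setIntegral_preimage_emb
    (measurableEmbedding_addLeft x) f (Ioi x)
  simpa using h

/-- Potter-type upper bound. -/
lemma potter {G : ℝ → ℝ} (hG : Antitone G) (hpos : ∀ x, 0 < G x) {η δ : ℝ} (hδ0 : 0 < δ)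
    (hδ : δ < η) (hrv : RegularlyVarying G (-η)) :
    ∀ᶠ t in atTop, ∀ s : ℝ, 1 ≤ s → G (t * s) / G t ≤ 2 ^ δ * s ^ (-δ) := by
  have h2 := (hrv 2 (by norm_num)).eventually_le_const
    (u := (2:ℝ) ^ (-δ)) (Real.rpow_lt_rpow_of_exponent_lt (by norm_num) (by linarith))
  obtain ⟨T, hT⟩ := eventually_atTop.1 h2
  filter_upwards [eventually_ge_atTop (max T 1)] with t ht s hs
  have ht1 : 1 ≤ t := le_trans (le_max_right _ _) ht
  have htT : T ≤ t := le_trans (le_max_left _ _) ht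
  have key : ∀ n : ℕ, G (t * 2 ^ n) ≤ ((2:ℝ) ^ (-δ)) ^ n * G t := by
    intro n
    induction n with
    | zero => simp
    | succ k ih =>
      have hp : (1:ℝ) ≤ 2 ^ k := one_le_pow₀ (by norm_num)
      have h := hT (t * 2 ^ k) (by nlinarith)
      rw [div_le_iff₀ (hpos _)] at h
      calc G (t * 2 ^ (k+1)) = G (t * 2 ^ k * 2) := by rw [pow_succ, mul_assoc]
        _ ≤ 2 ^ (-δ) * G (t * 2 ^ k) := h
        _ ≤ 2 ^ (-δ) * (((2:ℝ) ^ (-δ)) ^ k * G t) := by gcongr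
        _ = _ := by ring
  obtain ⟨n, hn1, hn2⟩ := exists_nat_pow_near hs (by norm_num : (1:ℝ) < 2)
  rw [div_le_iff₀ (hpos _)]
  have h3 : ((2:ℝ) ^ (-δ)) ^ n ≤ 2 ^ δ * s ^ (-δ) := by
    have e1 : ((2:ℝ) ^ (-δ)) ^ n = 2 ^ δ * ((2:ℝ) ^ (n+1)) ^ (-δ) := by
      rw [← Real.rpow_natCast, ← Real.rpow_natCast, ← Real.rpow_mul (by norm_num),
        ← Real.rpow_mul (by norm_num), ← Real.rpow_add (by norm_num)]
      congr 1; push_cast; ring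
    rw [e1]
    have := Real.rpow_le_rpow_of_nonpos (by linarith : 0 < s) hn2.le (by linarith : -δ ≤ 0)
    exact mul_le_mul_of_nonneg_left this (by positivity)
  calc G (t * s) ≤ G (t * 2 ^ n) := hG (by gcongr)
    _ ≤ _ := key n
    _ ≤ _ := by gcongr; exact (hpos t).le

lemma karamata {G : ℝ → ℝ} (hG : Antitone G) (hpos : ∀ x, 0 < G x) {η : ℝ} (hη : 1 < η)
    (hrv : RegularlyVarying G (-η)) :
    Tendsto (fun x => (∫ t in Ioi (0:ℝ), G (x + t)) / (x * G x)) atTop (𝓝 (1 / (η - 1))) := by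
  have hlim : Tendsto (fun x => ∫ s in Ioi (1:ℝ), G (x * s) / G x) atTop
      (𝓝 (∫ s in Ioi (1:ℝ), s ^ (-η))) := by
    apply tendsto_integral_filter_of_dominated_convergence
      (fun s => 2 ^ ((1 + η) / 2) * s ^ (-((1 + η) / 2)))
    · filter_upwards [eventually_ge_atTop 0] with x hx
      have : Antitone fun s => G (x * s) := fun a b hab => hG (by gcongr)
      exact (this.measurable.div_const _).aestronglyMeasurable
    · filter_upwards [potter hG hpos (by linarith : 0 < (1 + η) / 2) (by linarith) hrv] with t ht
      filter_upwards [ae_restrict_mem measurableSet_Ioi] with s hs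
      rw [Real.norm_of_nonneg (div_pos (hpos _) (hpos _)).le]
      exact ht s (le_of_lt hs)
    · exact (integrableOn_Ioi_rpow_of_lt (by linarith) one_pos).const_mul _
    · filter_upwards [ae_restrict_mem measurableSet_Ioi] with s hs
      exact hrv s (lt_trans one_pos hs)
  rw [integral_Ioi_rpow_of_lt (by linarith) one_pos] at hlim
  have e1 : -(1:ℝ) ^ (-η + 1) / (-η + 1) = 1 / (η - 1) := by
    rw [Real.one_rpow, show -η + 1 = -(η - 1) by ring, neg_div_neg_eq]
  rw [e1] at hlim
  refine hlim.congr' ?_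
  filter_upwards [eventually_gt_atTop 0] with x hx
  rw [shift_integral, integral_div, integral_comp_mul_left_Ioi _ _ hx]
  simp only [mul_one, smul_eq_mul]
  field_simp

/-- asymptotic inversion -/
lemma inversion {ι : Type*} {l : Filter ι} {G : ℝ → ℝ} (hG : Antitone G) (hpos : ∀ x, 0 < G x)
    {η : ℝ} (hη : 0 < η) (hrv : RegularlyVarying G (-η)) {a b : ι → ℝ}
    (hb : Tendsto b l atTop) {κ : ℝ} (hκ : 0 < κ)
    (h : Tendsto (fun i => G (a i) / G (b i)) l (𝓝 κ)) :
    Tendsto (fun i => a i / b i) l (𝓝 (κ ^ (-(1 / η)))) := by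
  have hc0 : 0 < κ ^ (-(1 / η)) := Real.rpow_pos_of_pos hκ _
  have hκe : (κ ^ (-(1 / η))) ^ (-η) = κ := by
    rw [← Real.rpow_mul hκ.le]
    have : -(1 / η) * -η = 1 := by field_simp
    rw [this, Real.rpow_one]
  have low : ∀ c, 0 < c → c < κ ^ (-(1 / η)) → ∀ᶠ i in l, c < a i / b i := by
    intro c hc0 hc
    have hlt : κ < c ^ (-η) := by
      conv_lhs => rw [← hκe]
      exact Real.rpow_lt_rpow_of_neg hc0 hc (by linarith)
    obtain ⟨m, hm1, hm2⟩ := exists_between hlt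
    filter_upwards [h.eventually_lt_const hm1, ((hrv c hc0).comp hb).eventually_const_lt hm2,
      hb.eventually_gt_atTop 0] with i h1 h2 h3
    rw [lt_div_iff₀ h3]
    by_contra hcon
    push Not at hcon
    have h4 : G (b i * c) ≤ G (a i) := hG (by linarith)
    have h5 : G (b i * c) / G (b i) ≤ G (a i) / G (b i) := by gcongr; exact (hpos _).le
    simp only [Function.comp] at h2
    linarith
  rw [tendsto_order]
  refine ⟨fun c hc => ?_, fun c hc => ?_⟩
  · filter_upwards [low (max c (κ ^ (-(1 / η)) / 2)) (lt_max_of_lt_right (by linarith))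
      (max_lt hc (by linarith))] with i hi
    exact lt_of_le_of_lt (le_max_left _ _) hi
  · have hcp : 0 < c := hc0.trans hc
    have hlt : c ^ (-η) < κ := by
      conv_rhs => rw [← hκe]
      exact Real.rpow_lt_rpow_of_neg hc0 hc (by linarith)
    obtain ⟨m, hm1, hm2⟩ := exists_between hlt
    filter_upwards [h.eventually_const_lt hm2, ((hrv c hcp).comp hb).eventually_lt_const hm1,
      hb.eventually_gt_atTop 0] with i h1 h2 h3
    rw [div_lt_iff₀ h3]
    by_contra hcon
    push Not at hcon
    have h4 : G (a i) ≤ G (b i * c) := hG (by linarith)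
    have h5 : G (a i) / G (b i) ≤ G (b i * c) / G (b i) := by gcongr; exact (hpos _).le
    simp only [Function.comp] at h2
    linarith

/-- `G(q(α))/(1-α) → 1`, abstractly -/
lemma quantile_asymp {ι : Type*} {l : Filter ι} {G : ℝ → ℝ} (hpos : ∀ x, 0 < G x)
    {η : ℝ} (hrv : RegularlyVarying G (-η)) {q p : ι → ℝ}
    (hq : Tendsto q l atTop) (h1 : ∀ᶠ i in l, G (q i) ≤ p i)
    (h2 : ∀ᶠ i in l, ∀ t, t < q i → p i ≤ G t) :
    Tendsto (fun i => p i / G (q i)) l (𝓝 1) := by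
  rw [tendsto_order]
  refine ⟨fun c hc => ?_, fun c hc => ?_⟩
  · filter_upwards [h1] with i hi
    exact hc.trans_le ((one_le_div (hpos _)).2 hi)
  · have hcont : Tendsto (fun x : ℝ => x ^ (-η)) (𝓝[<] 1) (𝓝 1) := by
      have : ContinuousAt (fun x : ℝ => x ^ (-η)) 1 :=
        Real.continuousAt_rpow_const _ _ (Or.inl one_ne_zero)
      have h := this.tendsto
      rw [Real.one_rpow] at h
      exact h.mono_left nhdsWithin_le_nhds
    obtain ⟨x, hx1, hx0, hxlt⟩ := ((hcont.eventually_lt_const hc).and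
      (Ioo_mem_nhdsLT (zero_lt_one' ℝ))).exists
    filter_upwards [((hrv x hx0).comp hq).eventually_lt_const hx1, h2,
      hq.eventually_gt_atTop 0] with i h3 h4 h5
    refine lt_of_le_of_lt ?_ h3
    simp only [Function.comp]
    have := h4 (q i * x) (by nlinarith)
    gcongr
    exact (hpos _).le

section prob
variable {Ω : Type*} [MeasurableSpace Ω] (P : Measure Ω) [IsProbabilityMeasure P] (L : Ω → ℝ)

lemma F_eq (hL : AEMeasurable L P) (t : ℝ) :
    (P {ω | L ω ≤ t}).toReal = ProbabilityTheory.cdf (P.map L) t := by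
  have := Measure.isProbabilityMeasure_map hL
  rw [ProbabilityTheory.cdf_eq_real, measureReal_def,
    Measure.map_apply_of_aemeasurable hL measurableSet_Iic]
  rfl

lemma quantile_le_iff (hL : AEMeasurable L P) {u t : ℝ} (hu0 : 0 < u) (hu1 : u < 1) :
    leftQuantile P L u ≤ t ↔ u ≤ (P {ω | L ω ≤ t}).toReal := by
  have hF : ∀ t, (P {ω | L ω ≤ t}).toReal = ProbabilityTheory.cdf (P.map L) t := F_eq P L hL
  unfold leftQuantile
  simp only [hF]
  set F := ProbabilityTheory.cdf (P.map L) with hFdef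
  have hne : {m : ℝ | u ≤ F m}.Nonempty := by
    obtain ⟨m, hm⟩ := ((ProbabilityTheory.tendsto_cdf_atTop (P.map L)).eventually_const_lt hu1).exists
    exact ⟨m, hm.le⟩
  have hbdd : BddBelow {m : ℝ | u ≤ F m} := by
    obtain ⟨m, hm⟩ := ((ProbabilityTheory.tendsto_cdf_atBot (P.map L)).eventually_lt_const hu0).exists
    refine ⟨m, fun y hy => ?_⟩
    by_contra hcon
    push Not at hcon
    have : F y ≤ F m := F.mono hcon.le
    have hy' : u ≤ F y := hy
    linarith
  constructor
  · intro h
    have hr : Tendsto F (𝓝[>] t) (𝓝 (F t)) :=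
      (F.right_continuous t).mono_left (nhdsWithin_mono _ Ioi_subset_Ici_self)
    refine ge_of_tendsto hr ?_
    filter_upwards [self_mem_nhdsWithin] with m hm
    obtain ⟨s, hs, hsm⟩ := exists_lt_of_csInf_lt hne (lt_of_le_of_lt h hm)
    exact le_trans hs (F.mono hsm.le)
  · intro h
    exact csInf_le hbdd h

lemma tail_lintegral (hL : AEMeasurable L P) (x : ℝ) :
    ∫⁻ ω, ENNReal.ofReal (max (L ω - x) 0) ∂P
      = ∫⁻ t in Ioi (0:ℝ), ENNReal.ofReal (1 - (P {ω | L ω ≤ x + t}).toReal) := by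
  rw [lintegral_eq_lintegral_meas_lt P (f := fun ω => max (L ω - x) 0)
    (ae_of_all _ fun ω => le_max_right _ _)
    ((hL.sub_const x).max aemeasurable_const)]
  refine setLIntegral_congr_fun measurableSet_Ioi fun t ht => ?_
  have ht0 : (0:ℝ) < t := ht
  have hs : {a | t < max (L a - x) 0} = {ω | L ω ≤ x + t}ᶜ := by
    ext ω
    simp only [mem_ofPred_eq, mem_compl_iff, lt_max_iff, not_le]
    constructor
    · rintro (h | h) <;> linarith
    · intro h; left; linarith
  simp only [hs]
  rw [prob_compl_eq_one_sub₀ (nullMeasurableSet_le hL aemeasurable_const),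
    ENNReal.ofReal_sub _ ENNReal.toReal_nonneg, ENNReal.ofReal_one,
    ENNReal.ofReal_toReal (measure_ne_top _ _)]

lemma F_mono : Monotone fun t => (P {ω | L ω ≤ t}).toReal := by
  intro a b hab
  exact ENNReal.toReal_mono (measure_ne_top _ _)
    (measure_mono fun ω (h : L ω ≤ a) => (h.trans hab : L ω ≤ b))

lemma F_le_one (t : ℝ) : (P {ω | L ω ≤ t}).toReal ≤ 1 :=
  ENNReal.toReal_le_of_le_ofReal zero_le_one (by simpa using prob_le_one)

lemma G_lintegral_toReal (x : ℝ) :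
    ∫ t in Ioi (0:ℝ), (1 - (P {ω | L ω ≤ x + t}).toReal)
     = (∫⁻ t in Ioi (0:ℝ), ENNReal.ofReal (1 - (P {ω | L ω ≤ x + t}).toReal)).toReal := by
  rw [integral_eq_lintegral_of_nonneg_ae]
  · exact ae_of_all _ fun t => sub_nonneg.2 (F_le_one P L _)
  · have : Monotone fun t => (P {ω | L ω ≤ x + t}).toReal :=
      fun a b hab => F_mono P L (by linarith)
    exact (measurable_const.sub this.measurable).aestronglyMeasurable

lemma tail_integral (hL : AEMeasurable L P) (x : ℝ) :
    ∫ ω, max (L ω - x) 0 ∂P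
      = ∫ t in Ioi (0:ℝ), (1 - (P {ω | L ω ≤ x + t}).toReal) := by
  rw [G_lintegral_toReal, ← tail_lintegral P L hL, integral_eq_lintegral_of_nonneg_ae]
  · exact ae_of_all _ fun ω => le_max_right _ _
  · exact ((hL.sub_const x).max aemeasurable_const).aestronglyMeasurable

lemma integral_quantile (hL : Integrable L P) {α : ℝ} (h0 : 0 < α) (h1 : α < 1) :
    ∫ u in α..1, leftQuantile P L u = (1 - α) * leftQuantile P L α
      + ∫ ω, max (L ω - leftQuantile P L α) 0 ∂P := by
  have hLm := hL.aemeasurable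
  set q := leftQuantile P L with hq
  have gal : ∀ {u t : ℝ}, 0 < u → u < 1 → (q u ≤ t ↔ u ≤ (P {ω | L ω ≤ t}).toReal) :=
    fun hu0 hu1 => quantile_le_iff P L hLm hu0 hu1
  have hmono : ∀ {u v : ℝ}, 0 < u → u ≤ v → v < 1 → q u ≤ q v := by
    intro u v hu huv hv
    rw [gal hu (by linarith)]
    exact huv.trans ((gal (by linarith) hv).1 le_rfl)
  have hmeas : AEMeasurable (fun u => q u - q α) (volume.restrict (Ioo α 1)) := by
    refine (aemeasurable_restrict_of_monotoneOn measurableSet_Ioo ?_).sub_const _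
    intro u hu v hv huv
    exact hmono (by linarith [hu.1]) huv hv.2
  have hnn : 0 ≤ᵐ[volume.restrict (Ioo α 1)] fun u => q u - q α := by
    filter_upwards [ae_restrict_mem measurableSet_Ioo] with u hu
    exact sub_nonneg.2 (hmono h0 hu.1.le hu.2)
  have hlin : ∫⁻ u in Ioo α 1, ENNReal.ofReal (q u - q α)
      = ∫⁻ ω, ENNReal.ofReal (max (L ω - q α) 0) ∂P := by
    rw [tail_lintegral P L hLm, lintegral_eq_lintegral_meas_lt _ hnn hmeas]
    refine setLIntegral_congr_fun measurableSet_Ioi fun t ht => ?_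
    have ht0 : (0:ℝ) < t := ht
    have hα : α ≤ (P {ω | L ω ≤ q α + t}).toReal := (gal h0 h1).1 (by linarith)
    rw [Measure.restrict_apply' measurableSet_Ioo]
    have hs : {a | t < q a - q α} ∩ Ioo α 1 = Ioo (P {ω | L ω ≤ q α + t}).toReal 1 := by
      ext u
      simp only [mem_inter_iff, mem_ofPred_eq, mem_Ioo]
      constructor
      · rintro ⟨h, hu1, hu2⟩
        refine ⟨?_, hu2⟩
        by_contra hcon
        push Not at hcon
        have := (gal (by linarith) hu2).2 hcon
        linarith
      · rintro ⟨h, hu2⟩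
        refine ⟨?_, by linarith, hu2⟩
        by_contra hcon
        push Not at hcon
        have := (gal (t := q α + t) (by linarith) hu2).1 (by linarith)
        linarith
    rw [hs, Real.volume_Ioo]
  have hposInt : Integrable (fun ω => max (L ω - q α) 0) P :=
    (hL.sub (integrable_const _)).pos_part
  have hnn2 : 0 ≤ᵐ[P] fun ω => max (L ω - q α) 0 := ae_of_all _ fun ω => le_max_right _ _
  have hqint : Integrable (fun u => q u - q α) (volume.restrict (Ioo α 1)) := by
    refine ⟨hmeas.aestronglyMeasurable, ?_⟩
    rw [hasFiniteIntegral_iff_ofReal hnn, hlin,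
      ← hasFiniteIntegral_iff_ofReal hnn2]
    exact hposInt.2
  have hval : ∫ u in Ioo α 1, (q u - q α) = ∫ ω, max (L ω - q α) 0 ∂P := by
    rw [integral_eq_lintegral_of_nonneg_ae hnn hmeas.aestronglyMeasurable, hlin,
      integral_eq_lintegral_of_nonneg_ae hnn2
        hposInt.aestronglyMeasurable]
  have hc : Integrable (fun _ : ℝ => q α) (volume.restrict (Ioo α 1)) := integrable_const _
  have hsum : ∫ u in Ioo α 1, q u = (∫ u in Ioo α 1, (q u - q α)) + ∫ _ in Ioo α 1, q α := by
    rw [← integral_add hqint hc]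
    simp
  rw [intervalIntegral.integral_of_le h1.le, integral_Ioc_eq_integral_Ioo, hsum, hval]
  simp [h1.le]
  ring

lemma expectile_eq (hL : Integrable L P) (hmean : (∫ ω, L ω ∂P) = 0) {α e : ℝ}
    (h : IsExpectile P L α e) :
    (2 * α - 1) * ∫ ω, max (L ω - e) 0 ∂P = (1 - α) * e := by
  unfold IsExpectile at h
  have hposInt : Integrable (fun ω => max (L ω - e) 0) P := (hL.sub (integrable_const _)).pos_part
  have h2 : ∫ ω, max (e - L ω) 0 ∂P = e + ∫ ω, max (L ω - e) 0 ∂P := by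
    have : ∀ ω, max (e - L ω) 0 = (e - L ω) + max (L ω - e) 0 := by
      intro ω
      rcases le_total (L ω) e with h | h
      · rw [max_eq_left (by linarith), max_eq_right (by linarith)]; ring
      · rw [max_eq_right (by linarith), max_eq_left (by linarith)]; ring
    have hi2 : Integrable (fun ω => e - L ω) P := (integrable_const _).sub hL
    simp_rw [this]
    rw [integral_add hi2 hposInt, integral_sub (integrable_const _) hL, hmean]
    simp
  rw [h2] at h
  linarith

end prob
end FFO

/-- for centered `L` with `1 - F ∈ RV_{-η}`, `η > 1` (Fréchet MDA), as
`α ↗ 1`: `(1-β*)/(1-α) → η - 1` where `β* = P[L ≤ e_α(L)]`, and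
`e_α(L)/ES_α(L) → (η-1)^{(η-1)/η}/η`. -/
theorem frechet_first_order {Ω : Type*} [MeasurableSpace Ω] (P : Measure Ω)
    [IsProbabilityMeasure P] (L : Ω → ℝ) (hL : Integrable L P)
    (hmean : (∫ ω, L ω ∂P) = 0) (η : ℝ) (hη : 1 < η)
    (hrv : RegularlyVarying (fun t => 1 - (P {ω | L ω ≤ t}).toReal) (-η))
    (e : ℝ → ℝ) (he : ∀ α : ℝ, 1 / 2 ≤ α → α < 1 → IsExpectile P L α (e α)) :
    Tendsto (fun α => (1 - (P {ω | L ω ≤ e α}).toReal) / (1 - α))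
        (𝓝[<] (1 : ℝ)) (𝓝 (η - 1)) ∧
      Tendsto (fun α => e α / ES P L α) (𝓝[<] (1 : ℝ))
        (𝓝 ((η - 1) ^ ((η - 1) / η) / η)) := by
  have hLm := hL.aemeasurable
  have hη1 : 0 < η - 1 := by linarith
  obtain ⟨G, hGdef⟩ : ∃ G : ℝ → ℝ, G = fun t => 1 - (P {ω | L ω ≤ t}).toReal := ⟨_, rfl⟩
  have hGt : ∀ t, 1 - (P {ω | L ω ≤ t}).toReal = G t := fun t => by rw [hGdef]
  rw [← hGdef] at hrv
  have hGa : Antitone G := fun a b hab => by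
    rw [hGdef]; exact sub_le_sub_left (FFO.F_mono P L hab) _
  have hG0 : ∀ x, 0 ≤ G x := fun x => by
    rw [hGdef]; exact sub_nonneg.2 (FFO.F_le_one P L _)
  have hpos : ∀ x, 0 < G x := by
    intro x
    have h1 := (hrv 1 one_pos).eventually_const_lt (u := 0) (by simp)
    obtain ⟨y, hy, hxy⟩ := (h1.and (eventually_ge_atTop x)).exists
    have hy0 : G y ≠ 0 := by
      intro h
      rw [h] at hy
      simp at hy
    exact lt_of_lt_of_le (lt_of_le_of_ne (hG0 y) hy0.symm) (hGa hxy)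
  obtain ⟨pi, hpi⟩ : ∃ pi : ℝ → ℝ, pi = fun x => ∫ ω, max (L ω - x) 0 ∂P := ⟨_, rfl⟩
  have hpix : ∀ x, ∫ ω, max (L ω - x) 0 ∂P = pi x := fun x => by rw [hpi]
  have hpiG : ∀ x, pi x = ∫ t in Ioi (0:ℝ), G (x + t) := fun x => by
    rw [← hpix, FFO.tail_integral P L hLm, hGdef]
  have hposInt : ∀ x, Integrable (fun ω => max (L ω - x) 0) P :=
    fun x => (hL.sub (integrable_const _)).pos_part
  have hpi_anti : Antitone pi := fun a b hab => by
    rw [hpi]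
    refine integral_mono (hposInt b) (hposInt a) fun ω => ?_
    exact max_le_max (by linarith) le_rfl
  have hkar : Tendsto (fun x => pi x / (x * G x)) atTop (𝓝 (1 / (η - 1))) := by
    simp_rw [hpiG]
    exact FFO.karamata hGa hpos hη hrv
  have hpi_pos : ∀ x, 0 < pi x := by
    intro x
    have h1 := hkar.eventually_const_lt (u := 0) (by positivity)
    obtain ⟨y, ⟨hy, hxy⟩, hy0⟩ := ((h1.and (eventually_ge_atTop x)).and (eventually_gt_atTop 0)).exists
    refine lt_of_lt_of_le ?_ (hpi_anti hxy)
    have : 0 < y * G y := mul_pos hy0 (hpos y)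
    exact (div_pos_iff_of_pos_right this).1 hy
  -- neighbourhoods of 1 from the left
  have hnear : ∀ c : ℝ, c < 1 → ∀ᶠ α in 𝓝[<] (1:ℝ), c < α ∧ α < 1 := fun c hc =>
    Ioo_mem_nhdsLT hc
  have hid : Tendsto (fun α : ℝ => α) (𝓝[<] 1) (𝓝 1) := tendsto_id.mono_left nhdsWithin_le_nhds
  have hexp : ∀ᶠ α in 𝓝[<] (1:ℝ), (2 * α - 1) * pi (e α) = (1 - α) * e α := by
    filter_upwards [hnear (1/2) (by norm_num)] with α hα
    rw [← hpix]
    exact FFO.expectile_eq P L hL hmean (he α hα.1.le hα.2)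
  have hetop : Tendsto e (𝓝[<] 1) atTop := by
    rw [tendsto_atTop]
    intro M
    have h1 : Tendsto (fun α : ℝ => (2 * α - 1) * pi M - (1 - α) * M) (𝓝[<] 1)
        (𝓝 ((2 * 1 - 1) * pi M - (1 - 1) * M)) :=
      (((hid.const_mul 2).sub_const 1).mul_const _).sub ((hid.const_sub 1).mul_const _)
    have h2 := h1.eventually_const_lt (u := 0) (by have := hpi_pos M; linarith)
    filter_upwards [h2, hexp, hnear (1/2) (by norm_num)] with α h3 h4 ⟨h5, h6⟩
    by_contra hcon
    push Not at hcon
    have h7 : (2 * α - 1) * pi M ≤ (2 * α - 1) * pi (e α) :=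
      mul_le_mul_of_nonneg_left (hpi_anti hcon.le) (by linarith)
    have h8 : (1 - α) * e α ≤ (1 - α) * M := mul_le_mul_of_nonneg_left hcon.le (by linarith)
    linarith
  -- part (i)
  have part1 : Tendsto (fun α => G (e α) / (1 - α)) (𝓝[<] (1 : ℝ)) (𝓝 (η - 1)) := by
    have h1 := (hkar.comp hetop).inv₀ (by positivity)
    have h2 : Tendsto (fun α : ℝ => (2 * α - 1)⁻¹) (𝓝[<] 1) (𝓝 (2 * 1 - 1)⁻¹) :=
      ((hid.const_mul 2).sub_const 1).inv₀ (by norm_num)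
    have h3 := h1.mul h2
    rw [show (1 / (η - 1))⁻¹ * (2 * 1 - 1)⁻¹ = η - 1 by norm_num] at h3
    refine h3.congr' ?_
    filter_upwards [hexp, hnear (1/2) (by norm_num), hetop.eventually_gt_atTop 0]
      with α h4 ⟨h5, h6⟩ h7
    simp only [Function.comp]
    have hp := hpi_pos (e α)
    have hG := hpos (e α)
    have h8 : 0 < 1 - α := by linarith
    have h9 : 0 < 2 * α - 1 := by linarith
    rw [inv_div, ← div_eq_mul_inv, div_div, div_eq_div_iff (by positivity) (by positivity)]
    linear_combination (-G (e α)) * h4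
  refine ⟨by simpa only [hGt] using part1, ?_⟩
  -- quantiles
  obtain ⟨q, hq⟩ : ∃ q : ℝ → ℝ, q = leftQuantile P L := ⟨_, rfl⟩
  have gal : ∀ {u t : ℝ}, 0 < u → u < 1 → (q u ≤ t ↔ G t ≤ 1 - u) := by
    intro u t hu0 hu1
    rw [hq, FFO.quantile_le_iff P L hLm hu0 hu1, ← hGt]
    constructor <;> intro h <;> linarith
  have hqtop : Tendsto q (𝓝[<] 1) atTop := by
    rw [tendsto_atTop]
    intro M
    have hM := hpos M
    filter_upwards [hnear (1 - G M) (by linarith), hnear 0 one_pos] with α ⟨h1, h2⟩ ⟨h3, _⟩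
    by_contra hcon
    push Not at hcon
    have := (gal h3 h2).1 hcon.le
    linarith
  have hqG : Tendsto (fun α => (1 - α) / G (q α)) (𝓝[<] 1) (𝓝 1) := by
    refine FFO.quantile_asymp (p := fun α => 1 - α) hpos hrv hqtop ?_ ?_
    · filter_upwards [hnear 0 one_pos] with α ⟨h1, h2⟩
      exact (gal h1 h2).1 le_rfl
    · filter_upwards [hnear 0 one_pos] with α ⟨h1, h2⟩ t ht
      by_contra hcon
      push Not at hcon
      have := (gal h1 h2).2 hcon.le
      linarith
  have heq : Tendsto (fun α => e α / q α) (𝓝[<] 1) (𝓝 ((η - 1) ^ (-(1 / η)))) := by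
    refine FFO.inversion hGa hpos (by linarith) hrv hqtop hη1 ?_
    have h := part1.mul hqG
    rw [mul_one] at h
    refine h.congr' ?_
    filter_upwards [hnear 0 one_pos] with α ⟨h1, h2⟩
    have : 1 - α ≠ 0 := by linarith
    have := (hpos (q α)).ne'
    field_simp
  have hES : Tendsto (fun α => ES P L α / q α) (𝓝[<] 1) (𝓝 (η / (η - 1))) := by
    have h1 := ((hkar.comp hqtop).mul (hqG.inv₀ one_ne_zero)).const_add 1
    rw [show 1 + 1 / (η - 1) * 1⁻¹ = η / (η - 1) by field_simp; ring] at h1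
    refine h1.congr' ?_
    filter_upwards [hnear 0 one_pos, hqtop.eventually_gt_atTop 0] with α ⟨h2, h3⟩ h4
    have h5 : 1 - α ≠ 0 := by linarith
    have h6 := (hpos (q α)).ne'
    unfold ES
    rw [FFO.integral_quantile P L hL h2 h3, hpix, ← hq]
    simp only [Function.comp]
    field_simp
  have hfin := heq.div hES (by positivity)
  have hval : (η - 1) ^ (-(1 / η)) / (η / (η - 1)) = (η - 1) ^ ((η - 1) / η) / η := by
    have : (η - 1) / η = -(1 / η) + 1 := by field_simp; ring
    rw [this, Real.rpow_add hη1, Real.rpow_one]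
    field_simp
  rw [hval] at hfin
  refine hfin.congr' ?_
  filter_upwards [hqtop.eventually_gt_atTop 0] with α h
  simp only [Pi.div_apply]
  rw [div_div_div_cancel_right₀ h.ne']
end

section
/- Let L be an integrable real random variable with E[L] = 0 whose distribution function F satisfies 1−F ∈ 2RV_{−η,ρ} with η > 1 and ρ ≤ 0, with auxiliary function A, and set β* = P[L ≤ e_α(L)]. Then, as α ↗ 1, [ ((1−β*)/(1−α)) · ((2α−1)/(η−1)) − 1 ] / A(q_α) → −(η−1)^{−ρ/η}/(η−ρ−1), i.e. (1−β*)/(1−α) = ((η−1)/(2α−1))·(1 − ((η−1)^{−ρ/η}/(η−ρ−1))·A(q_α) + o(A(q_α))), where q_α = q_L(α). -/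
open MeasureTheory Filter Topology Real Set
open scoped ENNReal

lemma uct (ψ b J : ℝ → ℝ) (hψ : Measurable ψ) (M C : ℝ) (hM : 0 ≤ M)
    (hb : ∀ᶠ s in atTop, b s ≠ 0)
    (hC : ∀ᶠ s in atTop, ∀ u ∈ Icc (0:ℝ) 1, |b (s + u)| ≤ C * |b s|)
    (hJ : ∀ u ∈ Icc (0:ℝ) 2, |J u| < M)
    (hlim : ∀ u ∈ Icc (0:ℝ) 2, Tendsto (fun s => (ψ (s + u) - ψ s) / b s) atTop (𝓝 (J u))) :
    ∀ᶠ s in atTop, ∀ u ∈ Icc (0:ℝ) 1, |ψ (s + u) - ψ s| ≤ (M + M * C) * |b s| := by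
  set bad : ℝ → Set ℝ := fun s => Icc (0:ℝ) 2 ∩ {v | M ≤ |(ψ (s + v) - ψ s) / b s|} with hbad
  have hbm : ∀ s, MeasurableSet (bad s) := by
    intro s
    refine measurableSet_Icc.inter (measurableSet_le measurable_const ?_)
    have : Measurable fun v => (ψ (s + v) - ψ s) / b s := by fun_prop
    exact this.abs
  have ht : Tendsto (fun s => volume (bad s)) atTop (𝓝 (volume (∅ : Set ℝ))) := by
    refine tendsto_measure_of_tendsto_indicator (B := Icc (0:ℝ) 2) atTop hbm
      measurableSet_Icc (by simp) (Eventually.of_forall fun s => inter_subset_left) ?_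
    intro v
    by_cases hv : v ∈ Icc (0:ℝ) 2
    · have := ((hlim v hv).abs).eventually_lt_const (hJ v hv)
      filter_upwards [this] with s hs
      simp [hbad, hs]
    · exact Eventually.of_forall fun s => by simp only [hbad]; simp [mem_inter_iff, hv]
  rw [measure_empty] at ht
  have hlt : ∀ᶠ s in atTop, volume (bad s) < ENNReal.ofReal (1/2) :=
    ht.eventually_lt_const (by simp)
  obtain ⟨s0, hs0⟩ := eventually_atTop.1 (hlt.and (hb.and hC))
  filter_upwards [eventually_ge_atTop s0] with s hs u hu
  obtain ⟨h1, hb1, hC1⟩ := hs0 s hs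
  obtain ⟨h2, hb2, -⟩ := hs0 (s + u) (by linarith [hu.1])
  have hex : ∃ w ∈ Icc (1:ℝ) 2, w ∉ bad s ∧ w - u ∉ bad (s + u) := by
    by_contra! hcon
    have hsub : Icc (1:ℝ) 2 ⊆ bad s ∪ (fun w => w - u) ⁻¹' bad (s + u) := by
      intro w hw
      by_cases h : w ∈ bad s
      · exact Or.inl h
      · exact Or.inr (hcon w hw h)
    have hv : volume ((fun w => w - u) ⁻¹' bad (s + u)) = volume (bad (s + u)) := by
      simp only [sub_eq_add_neg]
      exact measure_preimage_add_right volume (-u) _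
    have h3 := (measure_mono hsub).trans (measure_union_le (μ := volume) _ _)
    rw [hv, Real.volume_Icc] at h3
    have h4 : volume (bad s) + volume (bad (s + u)) < ENNReal.ofReal (1/2) + ENNReal.ofReal (1/2) :=
      ENNReal.add_lt_add h1 h2
    rw [← ENNReal.ofReal_add (by norm_num) (by norm_num)] at h4
    have := h3.trans_lt h4
    norm_num at this
  obtain ⟨w, hw, hw1, hw2⟩ := hex
  have k1 : |(ψ (s + w) - ψ s) / b s| < M := by
    by_contra! h
    exact hw1 ⟨⟨by linarith [hw.1], hw.2⟩, h⟩
  have k2 : |(ψ (s + u + (w - u)) - ψ (s + u)) / b (s + u)| < M := by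
    by_contra! h
    exact hw2 ⟨⟨by linarith [hw.1, hu.2], by linarith [hw.2, hu.1]⟩, h⟩
  rw [abs_div, div_lt_iff₀ (abs_pos.2 hb1)] at k1
  rw [abs_div, div_lt_iff₀ (abs_pos.2 hb2), show s + u + (w - u) = s + w by ring] at k2
  have k3 := mul_le_mul_of_nonneg_left (hC1 u hu) hM
  have : ψ (s + u) - ψ s = (ψ (s + w) - ψ s) - (ψ (s + w) - ψ (s + u)) := by ring
  rw [this]
  have := abs_sub (ψ (s + w) - ψ s) (ψ (s + w) - ψ (s + u))
  nlinarith

/-- global growth bound by iteration -/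
lemma growth (ψ b : ℝ → ℝ) (δ M s0 : ℝ) (hδ : 0 < δ) (hM : 0 ≤ M)
    (hb : ∀ s ≥ s0, ∀ u ∈ Icc (0:ℝ) 1, |b (s + u)| ≤ exp (δ / 2) * |b s|)
    (hψ : ∀ s ≥ s0, ∀ u ∈ Icc (0:ℝ) 1, |ψ (s + u) - ψ s| ≤ M * |b s|) :
    ∀ s ≥ s0, ∀ u ≥ 0, |ψ (s + u) - ψ s| ≤ M / (1 - exp (-(δ/2))) * exp (δ * u) * |b s| := by
  have he : exp (-(δ/2)) < 1 := by rw [Real.exp_lt_one_iff]; linarith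
  have hpos : 0 < 1 - exp (-(δ/2)) := by linarith
  set N := M / (1 - exp (-(δ/2))) with hN
  have hMN : M = N * (1 - exp (-(δ/2))) := by rw [hN]; field_simp
  have hN0 : 0 ≤ N := div_nonneg hM hpos.le
  have key : ∀ n : ℕ, ∀ s ≥ s0, ∀ u ≥ (0:ℝ), u ≤ (n:ℝ) + 1 →
      |ψ (s + u) - ψ s| ≤ N * exp (δ * u) * |b s| := by
    intro n
    have base : ∀ s ≥ s0, ∀ u ≥ 0, u ≤ 1 → |ψ (s + u) - ψ s| ≤ N * exp (δ * u) * |b s| := by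
      intro s hs u hu hu1
      refine (hψ s hs u ⟨hu, hu1⟩).trans ?_
      gcongr
      have : 1 ≤ exp (δ * u) := Real.one_le_exp (by positivity)
      have h0 := exp_pos (-(δ/2))
      rw [hMN]
      gcongr
      linarith
    induction n with
    | zero => intro s hs u hu hu1; exact base s hs u hu (by simpa using hu1)
    | succ n ih =>
      intro s hs u hu hu1
      by_cases h : u ≤ 1
      · exact base s hs u hu h
      push Not at h
      push_cast at hu1
      have h1 := ih (s + 1) (by linarith) (u - 1) (by linarith) (by linarith)
      rw [show s + 1 + (u - 1) = s + u by ring] at h1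
      have h2 := hψ s hs 1 (by simp)
      have h3 := hb s hs 1 (by simp)
      have h4 : N * exp (δ * (u - 1)) * |b (s + 1)| ≤ N * exp (δ * (u-1)) * (exp (δ/2) * |b s|) := by
        gcongr
      have h5 : exp (δ * (u-1)) * exp (δ/2) ≤ exp (δ * u) * exp (-(δ/2)) := by
        rw [← Real.exp_add, ← Real.exp_add]
        apply le_of_eq; congr 1; ring
      have h6 : (1 - exp (-(δ/2))) ≤ exp (δ * u) * (1 - exp (-(δ/2))) := by
        have : 1 ≤ exp (δ * u) := Real.one_le_exp (by positivity)
        nlinarith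
      have h7 : |ψ (s + u) - ψ s| ≤ |ψ (s + u) - ψ (s+1)| + |ψ (s+1) - ψ s| := abs_sub_le _ _ _
      have h8 : N * |b s| * (exp (δ * (u-1)) * exp (δ/2)) ≤ N * |b s| * (exp (δ * u) * exp (-(δ/2))) := by
        gcongr
      have h9 : N * |b s| * (1 - exp (-(δ/2))) ≤ N * |b s| * (exp (δ * u) * (1 - exp (-(δ/2)))) := by
        gcongr
      rw [hMN] at h2
      nlinarith
  intro s hs u hu
  obtain ⟨n, hn⟩ := exists_nat_ge u
  exact key n s hs u hu (by linarith)

noncomputable def Hf (ρ x : ℝ) : ℝ := if ρ = 0 then Real.log x else (x ^ ρ - 1) / ρ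

lemma Hf_one (ρ : ℝ) : Hf ρ 1 = 0 := by simp [Hf]

lemma Hf_two_pos (ρ : ℝ) (hρ : ρ ≤ 0) : 0 < Hf ρ 2 := by
  unfold Hf
  split_ifs with h
  · exact Real.log_pos (by norm_num)
  · have h' : ρ < 0 := lt_of_le_of_ne hρ h
    apply div_pos_of_neg_of_neg _ h'
    have := Real.rpow_lt_one_of_one_lt_of_neg (show (1:ℝ) < 2 by norm_num) h'
    linarith

lemma Hf_mul (ρ x : ℝ) (hx : 0 < x) : Hf ρ (x * 2) - Hf ρ x = x ^ ρ * Hf ρ 2 := by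
  unfold Hf
  split_ifs with h
  · rw [h, Real.log_mul hx.ne' (by norm_num)]; simp
  · rw [Real.mul_rpow hx.le (by norm_num)]; field_simp; ring

lemma Hf_bound (ρ : ℝ) (hρ : ρ ≤ 0) (x : ℝ) (hx : 1 ≤ x) : |Hf ρ x| ≤ Real.log x := by
  have hlog := Real.log_nonneg hx
  unfold Hf
  split_ifs with h
  · rw [abs_of_nonneg hlog]
  · have h' : ρ < 0 := lt_of_le_of_ne hρ h
    have h1 : x ^ ρ ≤ 1 := Real.rpow_le_one_of_one_le_of_nonpos hx hρ
    have h2 : 1 + ρ * Real.log x ≤ x ^ ρ := by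
      rw [Real.rpow_def_of_pos (by linarith)]
      have := Real.add_one_le_exp (Real.log x * ρ)
      linarith
    rw [abs_of_nonneg (div_nonneg_of_nonpos (by linarith) hρ), div_le_iff_of_neg h']
    linarith

section
variable {g A : ℝ → ℝ} {η ρ : ℝ}

noncomputable def phi (g : ℝ → ℝ) (η t : ℝ) : ℝ := t ^ η * g t
noncomputable def Bf (g : ℝ → ℝ) (η t : ℝ) : ℝ := phi g η (t * 2) - phi g η t

lemma phi_meas (hg : Measurable g) : Measurable (phi g η) := by
  unfold phi; fun_prop

lemma Bf_meas (hg : Measurable g) : Measurable (Bf g η) := by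
  have := phi_meas (η := η) hg
  unfold Bf; fun_prop

lemma A_ne (h : SecondOrderRV g η ρ A) : ∀ᶠ t in atTop, A t ≠ 0 := by
  rcases h.2.2.1 with h | h
  · exact h.mono fun t ht => ht.ne'
  · exact h.mono fun t ht => ht.ne

lemma stepA (hpos : ∀ t, 0 < g t) (h : SecondOrderRV g η ρ A) (x : ℝ) (hx : 0 < x) :
    Tendsto (fun t => (phi g η (t * x) - phi g η t) / (A t * phi g η t)) atTop (𝓝 (Hf ρ x)) := by
  have h4 := (h.2.2.2 x hx).const_mul (x ^ η)
  have hxx : x ^ η * x ^ (-η) = 1 := by rw [← Real.rpow_add hx]; simp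
  have e1 : x ^ η * (if ρ = 0 then x ^ (-η) * Real.log x else x ^ (-η) * (x ^ ρ - 1) / ρ) = Hf ρ x := by
    unfold Hf
    split_ifs
    · rw [← mul_assoc, hxx, one_mul]
    · rw [← mul_div_assoc, ← mul_assoc, hxx, one_mul]
  rw [e1] at h4
  refine h4.congr' ?_
  filter_upwards [eventually_gt_atTop 0, A_ne h] with t ht hA
  have := hpos t
  have ht' : 0 < t ^ η := Real.rpow_pos_of_pos ht η
  unfold phi
  rw [Real.mul_rpow ht.le hx.le]
  rw [← mul_div_assoc, mul_sub, hxx]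
  field_simp

lemma stepB (hpos : ∀ t, 0 < g t) (h : SecondOrderRV g η ρ A) (x : ℝ) (hx : 0 < x) :
    Tendsto (fun t => Bf g η (t * x) / (A t * phi g η t)) atTop (𝓝 (x ^ ρ * Hf ρ 2)) := by
  rw [← Hf_mul ρ x hx]
  refine ((stepA hpos h (x * 2) (by positivity)).sub (stepA hpos h x hx)).congr fun t => ?_
  unfold Bf
  rw [← mul_assoc]
  ring

lemma stepE (hpos : ∀ t, 0 < g t) (h : SecondOrderRV g η ρ A) :
    Tendsto (fun t => Bf g η t / (A t * phi g η t)) atTop (𝓝 (Hf ρ 2)) := by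
  simpa using stepB hpos h 1 one_pos

lemma B_ne (hρ : ρ ≤ 0) (hpos : ∀ t, 0 < g t) (h : SecondOrderRV g η ρ A) :
    ∀ᶠ t in atTop, Bf g η t ≠ 0 := by
  filter_upwards [Tendsto.eventually_const_lt (Hf_two_pos ρ hρ) (stepE hpos h)] with t ht h0
  simp [h0] at ht

lemma Aphi_ne (hpos : ∀ t, 0 < g t) (h : SecondOrderRV g η ρ A) :
    ∀ᶠ t in atTop, A t * phi g η t ≠ 0 := by
  filter_upwards [A_ne h, eventually_gt_atTop 0] with t hA ht
  have := hpos t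
  have ht' : 0 < t ^ η := Real.rpow_pos_of_pos ht η
  unfold phi
  positivity

lemma stepC (hρ : ρ ≤ 0) (hpos : ∀ t, 0 < g t) (h : SecondOrderRV g η ρ A) (x : ℝ) (hx : 0 < x) :
    Tendsto (fun t => Bf g η (t * x) / Bf g η t) atTop (𝓝 (x ^ ρ)) := by
  have hH := (Hf_two_pos ρ hρ).ne'
  have := (stepB hpos h x hx).div (stepE hpos h) hH
  rw [mul_div_cancel_right₀ _ hH] at this
  refine this.congr' ?_
  filter_upwards [Aphi_ne hpos h] with t ht
  simp only [Pi.div_apply]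
  rw [div_div_div_cancel_right₀ ht]

lemma stepD (hρ : ρ ≤ 0) (hpos : ∀ t, 0 < g t) (h : SecondOrderRV g η ρ A) (x : ℝ) (hx : 0 < x) :
    Tendsto (fun t => (phi g η (t * x) - phi g η t) / Bf g η t) atTop (𝓝 (Hf ρ x / Hf ρ 2)) := by
  have hH := (Hf_two_pos ρ hρ).ne'
  have := (stepA hpos h x hx).div (stepE hpos h) hH
  refine this.congr' ?_
  filter_upwards [Aphi_ne hpos h] with t ht
  simp only [Pi.div_apply]
  rw [div_div_div_cancel_right₀ ht]

lemma stepF (hρ : ρ ≤ 0) (hg : Measurable g) (hpos : ∀ t, 0 < g t) (h : SecondOrderRV g η ρ A)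
    (ε : ℝ) (hε : 0 < ε) :
    ∀ᶠ s in atTop, ∀ u ∈ Icc (0:ℝ) 1,
      |(Real.log |Bf g η (exp (s + u))| - ρ * (s + u)) - (Real.log |Bf g η (exp s)| - ρ * s)| ≤ ε := by
  have hm := Bf_meas (η := η) hg
  have := uct (fun s => Real.log |Bf g η (exp s)| - ρ * s) (fun _ => 1) (fun _ => 0)
    (by
      have : Measurable fun s => |Bf g η (exp s)| := (hm.comp Real.measurable_exp).abs
      have := this.log
      fun_prop) (ε / 2) 1 (by positivity) (by simp) (by simp)
    (by intro u _; simpa using hε) ?_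
  · filter_upwards [this] with s hs u hu
    refine (hs u hu).trans (le_of_eq ?_)
    simp
  · intro u hu
    have h1 := ((stepC hρ hpos h (exp u) (exp_pos u)).comp Real.tendsto_exp_atTop)
    have h2 := ((h1.log (by positivity)).sub_const (ρ * u))
    rw [← Real.exp_mul, Real.log_exp, mul_comm u, sub_self] at h2
    refine h2.congr' ?_
    have hn := Real.tendsto_exp_atTop.eventually (B_ne hρ hpos h)
    have hn2 := (tendsto_atTop_add_const_right atTop u tendsto_id).eventually hn
    filter_upwards [hn, hn2] with s hs hs2
    simp only [id_eq] at hs2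
    simp only [Function.comp, div_one]
    rw [← Real.exp_add, Real.log_div hs2 hs, Real.log_abs, Real.log_abs]
    ring

lemma stepH (hρ : ρ ≤ 0) (hg : Measurable g) (hpos : ∀ t, 0 < g t) (h : SecondOrderRV g η ρ A)
    (δ : ℝ) (hδ : 0 < δ) :
    ∃ N, ∀ᶠ t in atTop, ∀ x ≥ (1:ℝ),
      |phi g η (t * x) - phi g η t| ≤ N * x ^ δ * |Bf g η t| := by
  have hb : ∀ᶠ s in atTop, ∀ u ∈ Icc (0:ℝ) 1,
      |Bf g η (exp (s + u))| ≤ exp (δ/2) * |Bf g η (exp s)| := by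
    have hn := Real.tendsto_exp_atTop.eventually (B_ne hρ hpos h)
    obtain ⟨s0, hs0⟩ := eventually_atTop.1 hn
    filter_upwards [stepF hρ hg hpos h (δ/2) (by positivity), eventually_ge_atTop s0] with s hs hs' u hu
    have h1 := abs_pos.2 (hs0 s hs')
    have h2 := abs_pos.2 (hs0 (s + u) (by linarith [hu.1]))
    have h3 := (abs_le.1 (hs u hu)).2
    have h4 : ρ * u ≤ 0 := mul_nonpos_of_nonpos_of_nonneg hρ hu.1
    rw [← Real.log_le_log_iff h2 (by positivity), Real.log_mul (by positivity) h1.ne', Real.log_exp]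
    linarith
  have hφ := uct (fun s => phi g η (exp s)) (fun s => Bf g η (exp s)) (fun u => Hf ρ (exp u) / Hf ρ 2)
    ((phi_meas hg).comp Real.measurable_exp) (3 / Hf ρ 2) (exp (δ/2))
    (by have := Hf_two_pos ρ hρ; positivity)
    (Real.tendsto_exp_atTop.eventually (B_ne hρ hpos h)) hb
    (by
      intro u hu
      have := Hf_two_pos ρ hρ
      rw [abs_div, abs_of_pos this]
      gcongr
      have := Hf_bound ρ hρ (exp u) (Real.one_le_exp hu.1)
      rw [Real.log_exp] at this
      linarith [hu.2])
    (by
      intro u hu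
      have h1 := ((stepD hρ hpos h (exp u) (exp_pos u)).comp Real.tendsto_exp_atTop)
      refine h1.congr fun s => ?_
      simp only [Function.comp, Real.exp_add])
  obtain ⟨s0, hs0⟩ := eventually_atTop.1 (hb.and hφ)
  have hH := Hf_two_pos ρ hρ
  have key := growth (fun s => phi g η (exp s)) (fun s => Bf g η (exp s)) δ _ s0 hδ
    (by positivity) (fun s hs => (hs0 s hs).1) (fun s hs => (hs0 s hs).2)
  refine ⟨(3 / Hf ρ 2 + 3 / Hf ρ 2 * rexp (δ / 2)) / (1 - rexp (-(δ / 2))), ?_⟩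
  · filter_upwards [eventually_gt_atTop 0, Real.tendsto_log_atTop.eventually_ge_atTop s0] with t ht hts x hx
    have hx0 : 0 < x := by linarith
    have := key (Real.log t) hts (Real.log x) (Real.log_nonneg hx)
    simp only [Real.exp_add, Real.exp_log ht, Real.exp_log hx0] at this
    rw [show exp (δ * Real.log x) = x ^ δ by rw [Real.rpow_def_of_pos hx0, mul_comm]] at this
    exact this

/-- uniform convergence for B along a filter -/
lemma stepG (hρ : ρ ≤ 0) (hg : Measurable g) (hpos : ∀ t, 0 < g t) (h : SecondOrderRV g η ρ A)
    {ι : Type*} {l : Filter ι} (e q : ι → ℝ) (c : ℝ) (hc : 0 < c)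
    (hq : Tendsto q l atTop) (hec : Tendsto (fun i => e i / q i) l (𝓝 c)) :
    Tendsto (fun i => |Bf g η (e i)| / |Bf g η (q i)|) l (𝓝 (c ^ ρ)) := by
  -- intermediate point r = q c
  set r : ι → ℝ := fun i => q i * c with hr
  have hrT : Tendsto r l atTop := hq.atTop_mul_const hc
  have hqpos := hq.eventually_gt_atTop 0
  have heT : Tendsto e l atTop := by
    refine (hq.atTop_mul_pos hc hec).congr' ?_
    filter_upwards [hqpos] with i hi
    field_simp
  have h1 : Tendsto (fun i => |Bf g η (r i)| / |Bf g η (q i)|) l (𝓝 (c ^ ρ)) := by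
    have := ((stepC hρ hpos h c hc).comp hq).abs
    rw [abs_of_pos (Real.rpow_pos_of_pos hc ρ)] at this
    refine this.congr fun i => ?_
    simp [abs_div, hr]
  have hlog : Tendsto (fun i => Real.log (e i) - Real.log (r i)) l (𝓝 0) := by
    have h2 : Tendsto (fun i => e i / q i / c) l (𝓝 1) := by
      simpa [hc.ne'] using hec.div_const c
    have h3 := h2.log one_ne_zero
    rw [Real.log_one] at h3
    refine h3.congr' ?_
    filter_upwards [hqpos, heT.eventually_gt_atTop 0] with i hi hei
    rw [div_div, Real.log_div hei.ne' (by positivity)]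
  set K : ℝ → ℝ := fun s => Real.log |Bf g η (exp s)| - ρ * s with hK
  have h4 : Tendsto (fun i => K (Real.log (e i)) - K (Real.log (r i))) l (𝓝 0) := by
    rw [Metric.tendsto_nhds]
    intro ε hε
    obtain ⟨s0, hs0⟩ := eventually_atTop.1 (stepF hρ hg hpos h (ε/2) (by positivity))
    have hl := (Metric.tendsto_nhds.1 hlog) 1 one_pos
    filter_upwards [hl, (Real.tendsto_log_atTop.comp heT).eventually_ge_atTop s0,
      (Real.tendsto_log_atTop.comp hrT).eventually_ge_atTop s0] with i hi he1 hr1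
    simp only [Function.comp] at he1 hr1
    rw [Real.dist_eq, sub_zero] at hi ⊢
    have hi' := abs_lt.1 hi
    rcases le_total (Real.log (r i)) (Real.log (e i)) with hle | hle
    · have := hs0 _ hr1 (Real.log (e i) - Real.log (r i)) ⟨by linarith, by linarith [hi'.2]⟩
      rw [add_sub_cancel] at this
      exact lt_of_le_of_lt this (by linarith)
    · have := hs0 _ he1 (Real.log (r i) - Real.log (e i)) ⟨by linarith, by linarith [hi'.1]⟩
      rw [add_sub_cancel] at this
      rw [abs_sub_comm]
      exact lt_of_le_of_lt this (by linarith)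
  have h5 : Tendsto (fun i => |Bf g η (e i)| / |Bf g η (r i)|) l (𝓝 1) := by
    have h6 := (h4.add (hlog.const_mul ρ)).rexp
    simp only [mul_zero, add_zero, Real.exp_zero] at h6
    refine h6.congr' ?_
    filter_upwards [heT.eventually (B_ne hρ hpos h), hrT.eventually (B_ne hρ hpos h),
      heT.eventually_gt_atTop 0, hrT.eventually_gt_atTop 0] with i hb1 hb2 he0 hr0
    simp only [hK, Real.exp_log he0, Real.exp_log hr0]
    rw [show ∀ a b c d : ℝ, a - ρ * b - (c - ρ * d) + ρ * (b - d) = a - c by intros; ring,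
      Real.exp_sub, Real.exp_log (abs_pos.2 hb1), Real.exp_log (abs_pos.2 hb2)]
  have h7 := h5.mul h1
  rw [one_mul] at h7
  refine h7.congr' ?_
  filter_upwards [hrT.eventually (B_ne hρ hpos h)] with i hb2
  have := abs_pos.2 hb2
  field_simp

/-- the same for `A` itself -/
lemma stepGA (hρ : ρ ≤ 0) (hg : Measurable g) (hpos : ∀ t, 0 < g t) (h : SecondOrderRV g η ρ A)
    {ι : Type*} {l : Filter ι} (e q : ι → ℝ) (c : ℝ) (hc : 0 < c)
    (hq : Tendsto q l atTop) (heT : Tendsto e l atTop)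
    (hec : Tendsto (fun i => e i / q i) l (𝓝 c))
    (hφ : Tendsto (fun i => phi g η (e i) / phi g η (q i)) l (𝓝 1)) :
    Tendsto (fun i => A (e i) / A (q i)) l (𝓝 (c ^ ρ)) := by
  have hH := Hf_two_pos ρ hρ
  have h1 := stepG hρ hg hpos h e q c hc hq hec
  have h2 := ((stepE hpos h).comp heT).abs
  have h3 := ((stepE hpos h).comp hq).abs
  have h4 := (h1.mul (h3.div h2 (by simpa using hH.ne'))).div hφ.abs (by simp)
  rw [div_self (by simpa using hH.ne'), mul_one, abs_one, div_one] at h4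
  refine h4.congr' ?_
  have hsign : ∀ᶠ i in l, |A (e i)| / |A (q i)| = A (e i) / A (q i) := by
    rcases h.2.2.1 with h | h
    · filter_upwards [heT.eventually h, hq.eventually h] with i h1 h2
      rw [abs_of_pos h1, abs_of_pos h2]
    · filter_upwards [heT.eventually h, hq.eventually h] with i h1 h2
      rw [abs_of_neg h1, abs_of_neg h2, neg_div_neg_eq]
  filter_upwards [hsign, heT.eventually (B_ne hρ hpos h), hq.eventually (B_ne hρ hpos h),
    heT.eventually (Aphi_ne hpos h), hq.eventually (Aphi_ne hpos h)] with i hi b1 b2 a1 a2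
  rw [← hi]
  simp only [Pi.div_apply, Function.comp, abs_div, abs_mul]
  obtain ⟨a1, p1⟩ := mul_ne_zero_iff.1 a1
  obtain ⟨a2, p2⟩ := mul_ne_zero_iff.1 a2
  rw [← abs_pos] at b1 b2 a1 a2 p1 p2
  field_simp

lemma integ_log (η : ℝ) (hη : 1 < η) :
    IntegrableOn (fun x : ℝ => x ^ (-η) * Real.log x) (Ioi 1) ∧
    ∫ x in Ioi (1:ℝ), x ^ (-η) * Real.log x = 1 / ((η - 1) * (η - 1)) := by
  have hne : (1 - η) ≠ 0 := by linarith
  set f : ℝ → ℝ := fun x => x ^ (1 - η) * Real.log x / (1 - η) - x ^ (1 - η) / ((1 - η) * (1 - η)) with hf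
  have hd : ∀ x ∈ Ici (1:ℝ), HasDerivAt f (x ^ (-η) * Real.log x) x := by
    intro x hx
    have hx0 : 0 < x := lt_of_lt_of_le one_pos hx
    have h1 : HasDerivAt (fun x : ℝ => x ^ (1 - η)) ((1 - η) * x ^ (1 - η - 1)) x :=
      Real.hasDerivAt_rpow_const (Or.inl hx0.ne')
    have h2 := Real.hasDerivAt_log hx0.ne'
    have h3 := ((h1.mul h2).div_const (1 - η)).sub (h1.div_const ((1 - η) * (1 - η)))
    refine h3.congr_deriv ?_
    have e1 : x ^ (1 - η) = x ^ (-η) * x := by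
      rw [show 1 - η = -η + 1 by ring, Real.rpow_add hx0, Real.rpow_one]
    rw [show 1 - η - 1 = -η by ring, e1]
    field_simp
    ring
  have hlim : Tendsto f atTop (𝓝 0) := by
    have h1 : Tendsto (fun x : ℝ => x ^ (1 - η)) atTop (𝓝 0) := by
      have := tendsto_rpow_neg_atTop (show 0 < η - 1 by linarith)
      simpa using this
    have h2 : Tendsto (fun x : ℝ => x ^ (1 - η) * Real.log x) atTop (𝓝 0) := by
      have := (isLittleO_log_rpow_atTop (show 0 < η - 1 by linarith)).tendsto_div_nhds_zero
      refine this.congr' ?_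
      filter_upwards [eventually_gt_atTop 0] with x hx
      rw [show 1 - η = -(η - 1) by ring, Real.rpow_neg hx.le]
      field_simp
    simpa using (h2.div_const (1 - η)).sub (h1.div_const ((1 - η) * (1 - η)))
  have hnn : ∀ x ∈ Ioi (1:ℝ), 0 ≤ x ^ (-η) * Real.log x := by
    intro x hx
    have hx : 1 < x := hx
    have := Real.log_nonneg hx.le
    positivity
  refine ⟨integrableOn_Ioi_deriv_of_nonneg' hd hnn hlim, ?_⟩
  rw [integral_Ioi_of_hasDerivAt_of_nonneg' hd hnn hlim]
  simp [hf]
  rw [show 1 - η = -(η - 1) by ring, inv_neg]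
  ring

lemma integ_H (hη : 1 < η) (hρ : ρ ≤ 0) :
    ∫ x in Ioi (1:ℝ), x ^ (-η) * Hf ρ x = 1 / ((η - 1) * (η - ρ - 1)) := by
  unfold Hf
  split_ifs with h
  · rw [(integ_log η hη).2, h, sub_zero]
  · have h1 : ∀ x ∈ Ioi (1:ℝ), x ^ (-η) * ((x ^ ρ - 1) / ρ) = (x ^ (ρ - η) - x ^ (-η)) / ρ := by
      intro x hx
      have hx0 : 0 < x := lt_trans one_pos hx
      rw [show ρ - η = -η + ρ by ring, Real.rpow_add hx0]
      ring
    rw [setIntegral_congr_fun measurableSet_Ioi h1, integral_div, integral_sub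
      (integrableOn_Ioi_rpow_of_lt (by linarith) one_pos)
      (integrableOn_Ioi_rpow_of_lt (by linarith) one_pos),
      integral_Ioi_rpow_of_lt (by linarith) one_pos, integral_Ioi_rpow_of_lt (by linarith) one_pos]
    simp only [Real.one_rpow]
    have a1 : ρ - η + 1 ≠ 0 := by linarith
    have a2 : -η + 1 ≠ 0 := by linarith
    have a3 : η - 1 ≠ 0 := by linarith
    have a4 : η - ρ - 1 ≠ 0 := by linarith
    field_simp
    ring

lemma stepI (hη : 1 < η) (hρ : ρ ≤ 0) (hg : Measurable g) (hpos : ∀ t, 0 < g t)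
    (h : SecondOrderRV g η ρ A) :
    Tendsto (fun t => ((∫ x in Ioi (1:ℝ), g (t * x)) / g t - 1 / (η - 1)) / A t) atTop
      (𝓝 (1 / ((η - 1) * (η - ρ - 1)))) := by
  have hH := Hf_two_pos ρ hρ
  set δ := (η - 1) / 2 with hδ
  have hδ0 : 0 < δ := by rw [hδ]; linarith
  obtain ⟨N, hN⟩ := stepH hρ hg hpos h δ hδ0
  set F : ℝ → ℝ → ℝ := fun t x => x ^ (-η) * ((phi g η (t * x) - phi g η t) / Bf g η t) with hF
  have hFm : ∀ t, Measurable (F t) := by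
    intro t
    have := phi_meas (η := η) hg
    simp only [hF]
    fun_prop
  have hbi : IntegrableOn (fun x : ℝ => N * x ^ (δ - η)) (Ioi 1) :=
    (integrableOn_Ioi_rpow_of_lt (by rw [hδ]; linarith) one_pos).const_mul N
  have hbd : ∀ᶠ t in atTop, ∀ᵐ x ∂(volume.restrict (Ioi (1:ℝ))), ‖F t x‖ ≤ N * x ^ (δ - η) := by
    filter_upwards [hN, B_ne hρ hpos h] with t ht hB
    rw [ae_restrict_iff' measurableSet_Ioi]
    refine Eventually.of_forall fun x hx => ?_
    have hx : 1 < x := hx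
    have hx0 : 0 < x := by linarith
    have hBp := abs_pos.2 hB
    have h1 := ht x hx.le
    have h2 : 0 < x ^ (-η) := Real.rpow_pos_of_pos hx0 _
    rw [Real.norm_eq_abs]
    simp only [hF]
    rw [abs_mul, abs_of_pos h2, abs_div, show δ - η = -η + δ by ring, Real.rpow_add hx0]
    calc x ^ (-η) * (|phi g η (t * x) - phi g η t| / |Bf g η t|) ≤ x ^ (-η) * (N * x ^ δ) := by
          gcongr
          rw [div_le_iff₀ hBp]
          exact h1
      _ = _ := by ring
  have hlim : Tendsto (fun t => ∫ x in Ioi (1:ℝ), F t x) atTop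
      (𝓝 (∫ x in Ioi (1:ℝ), x ^ (-η) * (Hf ρ x / Hf ρ 2))) := by
    refine tendsto_integral_filter_of_dominated_convergence (fun x => N * x ^ (δ - η))
      (Eventually.of_forall fun t => (hFm t).aestronglyMeasurable) hbd hbi ?_
    rw [ae_restrict_iff' measurableSet_Ioi]
    refine Eventually.of_forall fun x hx => ?_
    exact (stepD hρ hpos h x (lt_trans one_pos hx)).const_mul _
  have e1 : ∫ x in Ioi (1:ℝ), x ^ (-η) * (Hf ρ x / Hf ρ 2) = 1 / ((η - 1) * (η - ρ - 1)) / Hf ρ 2 := by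
    rw [← integ_H hη hρ, ← integral_div]
    congr 1; ext x; ring
  rw [e1] at hlim
  have hfin := hlim.mul (stepE hpos h)
  rw [div_mul_cancel₀ _ hH.ne'] at hfin
  refine hfin.congr' ?_
  filter_upwards [hbd, B_ne hρ hpos h, Aphi_ne hpos h, eventually_gt_atTop 0] with t hb hB hA ht
  have hgt := hpos t
  have htη : 0 < t ^ η := Real.rpow_pos_of_pos ht η
  have hFi : IntegrableOn (F t) (Ioi 1) := Integrable.mono' hbi (hFm t).aestronglyMeasurable hb
  have hpw : ∀ x ∈ Ioi (1:ℝ), g (t * x) = (Bf g η t / t ^ η) * F t x + g t * x ^ (-η) := by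
    intro x hx
    have hx0 : 0 < x := lt_trans one_pos hx
    have hxx : x ^ (-η) * x ^ η = 1 := by rw [← Real.rpow_add hx0]; simp
    simp only [hF, phi]
    rw [Real.mul_rpow ht.le hx0.le]
    field_simp
    linear_combination (-g (t * x)) * hxx
  rw [setIntegral_congr_fun measurableSet_Ioi hpw, integral_add (hFi.const_mul _)
    ((integrableOn_Ioi_rpow_of_lt (by linarith) one_pos).const_mul _), integral_const_mul,
    integral_const_mul, integral_Ioi_rpow_of_lt (by linarith) one_pos, Real.one_rpow]
  obtain ⟨hA1, -⟩ := mul_ne_zero_iff.1 hA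
  have a2 : -η + 1 ≠ 0 := by linarith
  have a3 : η - 1 ≠ 0 := by linarith
  rw [show (-1 : ℝ) / (-η + 1) = 1 / (η - 1) by field_simp; ring]
  unfold phi
  field_simp
  ring

lemma stepJ0 (hη : 1 < η) (hρ : ρ ≤ 0) (hg : Measurable g) (hpos : ∀ t, 0 < g t)
    (h : SecondOrderRV g η ρ A) :
    Tendsto (fun t => (∫ x in Ioi (1:ℝ), g (t * x)) / g t) atTop (𝓝 (1 / (η - 1))) := by
  have h1 := ((stepI hη hρ hg hpos h).mul h.2.1).add_const (1 / (η - 1))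
  rw [mul_zero, zero_add] at h1
  refine h1.congr' ?_
  filter_upwards [A_ne h] with t ht
  field_simp
  ring

lemma stepJ (hη : 1 < η) (hρ : ρ ≤ 0) (hg : Measurable g) (hpos : ∀ t, 0 < g t)
    (h : SecondOrderRV g η ρ A) :
    Tendsto (fun t => (1 / ((∫ x in Ioi (1:ℝ), g (t * x)) / g t * (η - 1)) - 1) / A t) atTop
      (𝓝 (-(1 / (η - ρ - 1)))) := by
  have a3 : 0 < η - 1 := by linarith
  have a4 : 0 < η - ρ - 1 := by linarith
  have h0 := stepJ0 hη hρ hg hpos h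
  have h1 := (stepI hη hρ hg hpos h).neg.div h0 (by positivity)
  have e1 : -(1 / ((η - 1) * (η - ρ - 1))) / (1 / (η - 1)) = -(1 / (η - ρ - 1)) := by
    field_simp
  rw [e1] at h1
  refine h1.congr' ?_
  filter_upwards [A_ne h, Tendsto.eventually_const_lt (show 0 < 1 / (η - 1) by positivity) h0] with t ht hJ
  simp only [Pi.div_apply]
  set J := (∫ x in Ioi (1:ℝ), g (t * x)) / g t
  field_simp
  ring

end

section
variable {F g : ℝ → ℝ} {η : ℝ}

lemma q_atTop (hF : Monotone F) (hF1 : ∀ t, F t < 1) (hT : Tendsto F atTop (𝓝 1)) :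
    Tendsto (fun α => sInf {m : ℝ | α ≤ F m}) (𝓝[<] (1:ℝ)) atTop := by
  rw [tendsto_atTop]
  intro K
  filter_upwards [Ioo_mem_nhdsLT (hF1 K)] with α hα
  obtain ⟨m, hm⟩ := (Tendsto.eventually_const_lt hα.2 hT).exists
  refine le_csInf ⟨m, hm.le⟩ fun y hy => ?_
  by_contra! hlt
  have : α ≤ F y := hy
  linarith [hF hlt.le, hα.1]

lemma q_prop (hF : Monotone F) (hF1 : ∀ t, F t < 1) (hT : Tendsto F atTop (𝓝 1)) :
    ∀ᶠ α in 𝓝[<] (1:ℝ), (∀ m < sInf {m : ℝ | α ≤ F m}, F m < α) ∧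
      (∀ m > sInf {m : ℝ | α ≤ F m}, α ≤ F m) := by
  filter_upwards [Ioo_mem_nhdsLT (hF1 0)] with α hα
  obtain ⟨m0, hm0⟩ := (Tendsto.eventually_const_lt hα.2 hT).exists
  have hne : {m : ℝ | α ≤ F m}.Nonempty := ⟨m0, hm0.le⟩
  have hbd : BddBelow {m : ℝ | α ≤ F m} := by
    refine ⟨0, fun y hy => ?_⟩
    by_contra! hlt
    have : α ≤ F y := hy
    linarith [hF hlt.le, hα.1]
  constructor
  · intro m hm
    by_contra! hle
    exact absurd (csInf_le hbd (show m ∈ {m : ℝ | α ≤ F m} from hle)) (not_le.2 hm)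
  · intro m hm
    obtain ⟨y, hy, hym⟩ := exists_lt_of_csInf_lt hne hm
    exact le_trans hy (hF hym.le)

lemma q_asymp (hpos : ∀ t, 0 < g t)
    (hRV : RegularlyVarying g (-η)) {l : Filter ℝ} (q : ℝ → ℝ) (hq : Tendsto q l atTop)
    (h1 : ∀ᶠ α in l, (∀ m < q α, 1 - α < g m) ∧ (∀ m > q α, g m ≤ 1 - α)) :
    Tendsto (fun α => (1 - α) / g (q α)) l (𝓝 1) := by
  have hcont : Tendsto (fun x : ℝ => x ^ (-η)) (𝓝 1) (𝓝 1) := by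
    have := (Real.continuousAt_rpow_const 1 (-η) (Or.inl one_ne_zero)).tendsto
    rwa [Real.one_rpow] at this
  rw [tendsto_order]
  constructor
  · intro a ha
    have h2 : ∀ᶠ x in 𝓝[>] (1:ℝ), a < x ^ (-η) :=
      (hcont.mono_left nhdsWithin_le_nhds).eventually_const_lt ha
    obtain ⟨x, hx, hx1⟩ := (h2.and self_mem_nhdsWithin).exists
    have hx1 : 1 < x := hx1
    have h3 := ((hRV x (by linarith)).comp hq).eventually_const_lt hx
    filter_upwards [h1, h3, hq.eventually_gt_atTop 0] with α hα h3 hq0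
    refine lt_of_lt_of_le h3 ?_
    have := hpos (q α)
    simp only [Function.comp]
    gcongr
    exact hα.2 _ (by nlinarith)
  · intro a ha
    have h2 : ∀ᶠ x in 𝓝[<] (1:ℝ), x ^ (-η) < a :=
      (hcont.mono_left nhdsWithin_le_nhds).eventually_lt_const ha
    obtain ⟨x, hx, hx1⟩ := (h2.and (Ioo_mem_nhdsLT one_pos)).exists
    have h3 := ((hRV x hx1.1).comp hq).eventually_lt_const hx
    filter_upwards [h1, h3, hq.eventually_gt_atTop 0] with α hα h3 hq0
    refine lt_of_le_of_lt ?_ h3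
    have := hpos (q α)
    simp only [Function.comp]
    gcongr
    exact (hα.1 _ (by nlinarith [hx1.2])).le

lemma ratio_inv (hη : 0 < η) (hg : Antitone g) (hpos : ∀ t, 0 < g t)
    (hRV : RegularlyVarying g (-η)) {ι : Type*} {l : Filter ι} (e q : ι → ℝ) (c : ℝ) (hc : 0 < c)
    (hq : Tendsto q l atTop)
    (h1 : Tendsto (fun i => g (e i) / g (q i)) l (𝓝 (c ^ (-η)))) :
    Tendsto (fun i => e i / q i) l (𝓝 c) := by
  rw [tendsto_order]
  constructor
  · intro a ha
    set b := max a (c / 2) with hb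
    have hbc : b < c := max_lt ha (by linarith)
    have hb0 : 0 < b := lt_of_lt_of_le (by linarith) (le_max_right a (c/2))
    have h2 : c ^ (-η) < b ^ (-η) := Real.rpow_lt_rpow_of_neg hb0 hbc (by linarith)
    obtain ⟨m, hm1, hm2⟩ := exists_between h2
    filter_upwards [h1.eventually_lt_const hm1, ((hRV b hb0).comp hq).eventually_const_lt hm2,
      hq.eventually_gt_atTop 0] with i k1 k2 hq0
    have k3 := k1.trans k2
    simp only [Function.comp] at k3
    rw [div_lt_div_iff_of_pos_right (hpos _)] at k3
    rw [lt_div_iff₀ hq0]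
    have k4 : q i * b < e i := by
      by_contra! hle
      exact absurd (hg hle) (not_le.2 k3)
    have : a ≤ b := le_max_left _ _
    nlinarith
  · intro b hb
    have hb0 : 0 < b := by linarith
    have h2 : b ^ (-η) < c ^ (-η) := Real.rpow_lt_rpow_of_neg hc hb (by linarith)
    obtain ⟨m, hm1, hm2⟩ := exists_between h2
    filter_upwards [h1.eventually_const_lt hm2, ((hRV b hb0).comp hq).eventually_lt_const hm1,
      hq.eventually_gt_atTop 0] with i k1 k2 hq0
    have k3 := k2.trans k1
    simp only [Function.comp] at k3
    rw [div_lt_div_iff_of_pos_right (hpos _)] at k3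
    rw [div_lt_iff₀ hq0]
    by_contra! hle
    exact absurd (hg (show q i * b ≤ e i by linarith)) (not_le.2 k3)
end

section
variable {Ω : Type*} [MeasurableSpace Ω] (P : Measure Ω) [IsProbabilityMeasure P] (L : Ω → ℝ)

lemma F_mono : Monotone fun t => (P {ω | L ω ≤ t}).toReal := by
  intro a b hab
  exact ENNReal.toReal_mono (measure_ne_top _ _) (measure_mono fun ω (h : L ω ≤ a) => h.trans hab)

lemma F_tendsto (hL : AEMeasurable L P) :
    Tendsto (fun t => (P {ω | L ω ≤ t}).toReal) atTop (𝓝 1) := by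
  have : IsProbabilityMeasure (P.map L) := Measure.isProbabilityMeasure_map hL
  refine (ProbabilityTheory.tendsto_cdf_atTop (P.map L)).congr fun t => ?_
  rw [ProbabilityTheory.cdf_eq_real, Measure.real, Measure.map_apply_of_aemeasurable hL measurableSet_Iic]
  rfl

lemma layer (hL : Integrable L P) (t : ℝ) (ht : 0 < t) :
    ∫ ω, max (L ω - t) 0 ∂P = t * ∫ x in Ioi (1:ℝ), (1 - (P {ω | L ω ≤ t * x}).toReal) := by
  have hi : Integrable (fun ω => max (L ω - t) 0) P := (hL.sub (integrable_const t)).pos_part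
  rw [hi.integral_eq_integral_meas_lt (Eventually.of_forall fun ω => le_max_right _ _)]
  set G : ℝ → ℝ := fun y => 1 - (P {ω | L ω ≤ y}).toReal with hG
  have h1 : ∀ s ∈ Ioi (0:ℝ), P.real {ω | s < max (L ω - t) 0} = G (s + t) := by
    intro s hs
    have hs : 0 < s := hs
    have : {ω | s < max (L ω - t) 0} = {ω | L ω ≤ s + t}ᶜ := by
      ext ω
      simp only [mem_ofPred_eq, lt_max_iff, mem_compl_iff, not_le]
      constructor
      · rintro (h | h) <;> linarith
      · intro h; left; linarith
    rw [this, probReal_compl_eq_one_sub₀ (nullMeasurableSet_le hL.aemeasurable aemeasurable_const)]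
    rfl
  rw [setIntegral_congr_fun measurableSet_Ioi h1]
  have h2 := integral_comp_mul_left_Ioi G 1 ht
  rw [mul_one] at h2
  have h3 : ∫ s in Ioi (0:ℝ), G (s + t) = ∫ y in Ioi t, G y := by
    have := (measurePreserving_add_right (volume : Measure ℝ) t).setIntegral_preimage_emb
      (measurableEmbedding_addRight t) G (Ioi t)
    simpa using this
  rw [h3, h2, smul_eq_mul, ← mul_assoc, mul_inv_cancel₀ ht.ne', one_mul]

lemma expect_eq (hL : Integrable L P) (hmean : (∫ ω, L ω ∂P) = 0) (α t : ℝ)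
    (h : IsExpectile P L α t) :
    (2 * α - 1) * ∫ ω, max (L ω - t) 0 ∂P = (1 - α) * t := by
  have hi : Integrable (fun ω => max (L ω - t) 0) P := (hL.sub (integrable_const t)).pos_part
  have h1 : ∫ ω, max (t - L ω) 0 ∂P = t + ∫ ω, max (L ω - t) 0 ∂P := by
    have : ∀ ω, max (t - L ω) 0 = (t - L ω) + max (L ω - t) 0 := by
      intro ω
      rcases le_total (L ω) t with h | h
      · rw [max_eq_left (by linarith), max_eq_right (by linarith)]; ring
      · rw [max_eq_right (by linarith), max_eq_left (by linarith)]; ring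
    simp_rw [this]
    have hi2 : Integrable (fun ω => t - L ω) P := (integrable_const t).sub hL
    rw [integral_add hi2 hi, integral_sub (integrable_const t) hL, hmean]
    simp
  unfold IsExpectile at h
  rw [h1] at h
  linarith
end

lemma G_pos {Ω : Type*} [MeasurableSpace Ω] (P : Measure Ω) [IsProbabilityMeasure P] (L : Ω → ℝ)
    (hL : Integrable L P) (K : ℝ) (hK : (P {ω | L ω ≤ K}).toReal < 1) :
    0 < ∫ ω, max (L ω - K) 0 ∂P := by
  have hi : Integrable (fun ω => max (L ω - K) 0) P := (hL.sub (integrable_const K)).pos_part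
  have hnn : 0 ≤ fun ω => max (L ω - K) 0 := fun ω => le_max_right _ _
  refine lt_of_le_of_ne (integral_nonneg hnn) fun h0 => ?_
  have h1 := (integral_eq_zero_iff_of_nonneg hnn hi).1 h0.symm
  have h2 : {ω | L ω ≤ K} =ᵐ[P] univ := by
    rw [eventuallyEq_univ]
    filter_upwards [h1] with ω hω
    have : max (L ω - K) 0 = 0 := hω
    have := le_max_left (L ω - K) 0
    show L ω ≤ K
    linarith
  rw [measure_congr h2] at hK
  simp at hK

/-- second-order expansion of `(1-β*)/(1-α)` for `1-F ∈ 2RV_{-η,ρ}`, `η > 1`: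
`[((1-β*)/(1-α))·((2α-1)/(η-1)) - 1]/A(q_α) → -(η-1)^{-ρ/η}/(η-ρ-1)` as `α ↗ 1`,
where `β* = P[L ≤ e_α(L)]`. -/
theorem frechet_second_order_beta {Ω : Type*} [MeasurableSpace Ω] (P : Measure Ω)
    [IsProbabilityMeasure P] (L : Ω → ℝ) (hL : Integrable L P)
    (hmean : (∫ ω, L ω ∂P) = 0) (η ρ : ℝ) (hη : 1 < η) (hρ : ρ ≤ 0) (A : ℝ → ℝ)
    (hrv2 : SecondOrderRV (fun t => 1 - (P {ω | L ω ≤ t}).toReal) η ρ A)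
    (e : ℝ → ℝ) (he : ∀ α : ℝ, 1 / 2 ≤ α → α < 1 → IsExpectile P L α (e α)) :
    Tendsto (fun α =>
        (((1 - (P {ω | L ω ≤ e α}).toReal) / (1 - α)) * ((2 * α - 1) / (η - 1)) - 1) /
          A (leftQuantile P L α))
      (𝓝[<] (1 : ℝ)) (𝓝 (-((η - 1) ^ (-ρ / η) / (η - ρ - 1)))) := by
  set F : ℝ → ℝ := fun t => (P {ω | L ω ≤ t}).toReal with hF
  set g : ℝ → ℝ := fun t => 1 - F t with hg
  have hFm : Monotone F := F_mono P L
  have hFT : Tendsto F atTop (𝓝 1) := F_tendsto P L hL.aemeasurable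
  have hgA : Antitone g := fun a b hab => by simp only [hg]; linarith [hFm hab]
  have hgm : Measurable g := hgA.measurable
  have hg0 : ∀ t, 0 ≤ g t := by
    intro t
    have : F t ≤ 1 := by
      have := (ENNReal.toReal_le_toReal (measure_ne_top P {ω | L ω ≤ t}) ENNReal.one_ne_top).2 prob_le_one
      simpa [hF] using this
    simp only [hg]; linarith
  have hpos : ∀ t, 0 < g t := by
    intro t
    have h1 := hrv2.1 1 one_pos
    rw [Real.one_rpow] at h1
    obtain ⟨s, hs, hst⟩ := ((h1.eventually_const_lt zero_lt_one).and (eventually_ge_atTop t)).exists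
    have hs' : g s ≠ 0 := by
      intro h0
      rw [h0] at hs
      simp at hs
    exact lt_of_lt_of_le (lt_of_le_of_ne (hg0 s) hs'.symm) (hgA hst)
  have hF1 : ∀ t, F t < 1 := by
    intro t; have := hpos t; simp only [hg] at this; linarith
  have hrv : SecondOrderRV g η ρ A := hrv2
  clear_value F
  set q : ℝ → ℝ := fun α => leftQuantile P L α with hq
  have hqe : q = fun α => sInf {m : ℝ | α ≤ F m} := by
    rw [hq, hF]; rfl
  have hqT : Tendsto q (𝓝[<] (1:ℝ)) atTop := by rw [hqe]; exact q_atTop hFm hF1 hFT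
  have hqp : ∀ᶠ α in 𝓝[<] (1:ℝ), (∀ m < q α, 1 - α < g m) ∧ (∀ m > q α, g m ≤ 1 - α) := by
    filter_upwards [q_prop hFm hF1 hFT] with α hα
    rw [hqe]
    exact ⟨fun m hm => by have := hα.1 m hm; simp only [hg]; linarith,
      fun m hm => by have := hα.2 m hm; simp only [hg]; linarith⟩
  have hqa := q_asymp hpos hrv.1 q hqT hqp
  have hnear : ∀ᶠ α in 𝓝[<] (1:ℝ), 1 / 2 < α ∧ α < 1 :=
    Ioo_mem_nhdsLT (by norm_num)
  have hid : Tendsto (fun α : ℝ => α) (𝓝[<] (1:ℝ)) (𝓝 1) := tendsto_id.mono_left nhdsWithin_le_nhds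
  have h2a : Tendsto (fun α : ℝ => 2 * α - 1) (𝓝[<] (1:ℝ)) (𝓝 1) := by
    have := (hid.const_mul 2).sub_const 1
    norm_num at this
    exact this
  have h1a : Tendsto (fun α : ℝ => 1 - α) (𝓝[<] (1:ℝ)) (𝓝 0) := by
    simpa using hid.const_sub 1
  have heq : ∀ α, 1 / 2 < α ∧ α < 1 →
      (2 * α - 1) * ∫ ω, max (L ω - e α) 0 ∂P = (1 - α) * e α := fun α hα =>
    expect_eq P L hL hmean α (e α) (he α hα.1.le hα.2)
  have heT : Tendsto e (𝓝[<] (1:ℝ)) atTop := by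
    rw [tendsto_atTop]
    intro K0
    set K := max K0 0
    have hG := G_pos P L hL K (by have := hF1 K; rwa [hF] at this)
    have hlim := (h2a.mul_const (∫ ω, max (L ω - K) 0 ∂P)).sub (h1a.mul_const K)
    rw [one_mul, zero_mul, sub_zero] at hlim
    filter_upwards [hnear, hlim.eventually_const_lt hG] with α hα hl
    by_contra! hlt
    have hle : e α ≤ K := hlt.le.trans (le_max_left _ _)
    have hmono : ∫ ω, max (L ω - K) 0 ∂P ≤ ∫ ω, max (L ω - e α) 0 ∂P := by
      refine integral_mono ((hL.sub (integrable_const K)).pos_part)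
        ((hL.sub (integrable_const (e α))).pos_part) fun ω => ?_
      exact max_le_max (by linarith) le_rfl
    have h1 := heq α hα
    have h2 : (2 * α - 1) * ∫ ω, max (L ω - K) 0 ∂P ≤ (2 * α - 1) * ∫ ω, max (L ω - e α) 0 ∂P :=
      mul_le_mul_of_nonneg_left hmono (by linarith [hα.1])
    have h3 : (1 - α) * e α ≤ (1 - α) * K := mul_le_mul_of_nonneg_left hle (by linarith [hα.2])
    linarith
  set J : ℝ → ℝ := fun t => (∫ x in Ioi (1:ℝ), g (t * x)) / g t with hJ
  have hJ0 : Tendsto J atTop (𝓝 (1 / (η - 1))) := stepJ0 hη hρ hgm hpos hrv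
  have hJ1 : Tendsto (fun t => (1 / (J t * (η - 1)) - 1) / A t) atTop (𝓝 (-(1 / (η - ρ - 1)))) :=
    stepJ hη hρ hgm hpos hrv
  have hη1 : 0 < η - 1 := by linarith
  -- the key identity
  have hkey : ∀ᶠ α in 𝓝[<] (1:ℝ), g (e α) / (1 - α) * (2 * α - 1) = 1 / J (e α) := by
    filter_upwards [hnear, heT.eventually_gt_atTop 0,
      heT.eventually (hJ0.eventually_const_lt (show 0 < 1 / (η - 1) by positivity))] with α hα he0 hJp
    have h1 := heq α hα
    have h2 := layer P L hL (e α) he0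
    have h3 : ∫ x in Ioi (1:ℝ), (1 - (P {ω | L ω ≤ e α * x}).toReal) = J (e α) * g (e α) := by
      simp only [hJ]
      rw [div_mul_cancel₀ _ (hpos _).ne']
      simp only [hg, hF]
    rw [h2, h3] at h1
    have h4 : 0 < 1 - α := by linarith [hα.2]
    have h5 : (2 * α - 1) * (J (e α) * g (e α)) = 1 - α := by
      have : e α * ((2 * α - 1) * (J (e α) * g (e α))) = e α * (1 - α) := by linarith
      exact mul_left_cancel₀ he0.ne' this
    rw [eq_div_iff hJp.ne', div_mul_eq_mul_div, div_mul_eq_mul_div, div_eq_iff h4.ne']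
    linarith
  set c : ℝ := (η - 1) ^ (-1 / η) with hc
  have hc0 : 0 < c := Real.rpow_pos_of_pos hη1 _
  have hcη : c ^ (-η) = η - 1 := by
    rw [hc, ← Real.rpow_mul hη1.le, show -1 / η * -η = 1 by field_simp, Real.rpow_one]
  have hge : Tendsto (fun α => g (e α) / g (q α)) (𝓝[<] (1:ℝ)) (𝓝 (c ^ (-η))) := by
    have h1 : Tendsto (fun α => 1 / J (e α)) (𝓝[<] (1:ℝ)) (𝓝 (1 / (1 / (η - 1)))) :=
      (tendsto_const_nhds).div (hJ0.comp heT) (by positivity)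
    have h2 := (h1.div h2a one_ne_zero).mul hqa
    rw [hcη]
    have e1 : 1 / (1 / (η - 1)) / 1 * 1 = η - 1 := by field_simp
    rw [e1] at h2
    refine h2.congr' ?_
    filter_upwards [hkey, hnear] with α hk hα
    have a1 : 0 < 1 - α := by linarith [hα.2]
    have a2 : 0 < 2 * α - 1 := by linarith [hα.1]
    simp only [Pi.div_apply]
    rw [← hk]
    rw [mul_div_cancel_right₀ _ a2.ne', div_mul_div_cancel₀ a1.ne']
  have hec : Tendsto (fun α => e α / q α) (𝓝[<] (1:ℝ)) (𝓝 c) :=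
    ratio_inv (by linarith) hgA hpos hrv.1 e q c hc0 hqT hge
  have hφ : Tendsto (fun α => phi g η (e α) / phi g η (q α)) (𝓝[<] (1:ℝ)) (𝓝 1) := by
    have h1 := (hec.rpow_const (p := η) (Or.inl hc0.ne')).mul hge
    rw [← Real.rpow_add hc0, add_neg_cancel, Real.rpow_zero] at h1
    refine h1.congr' ?_
    filter_upwards [heT.eventually_gt_atTop 0, hqT.eventually_gt_atTop 0] with α h1 h2
    unfold phi
    rw [Real.div_rpow h1.le h2.le, div_mul_div_comm]
  have hAA := stepGA hρ hgm hpos hrv e q c hc0 hqT heT hec hφ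
  have hfin := (hJ1.comp heT).mul hAA
  have e2 : c ^ ρ = (η - 1) ^ (-ρ / η) := by
    rw [hc, ← Real.rpow_mul hη1.le]
    congr 1; ring
  rw [e2, show -(1 / (η - ρ - 1)) * (η - 1) ^ (-ρ / η) = -((η - 1) ^ (-ρ / η) / (η - ρ - 1)) by ring] at hfin
  refine hfin.congr' ?_
  filter_upwards [hkey, heT.eventually (A_ne hrv)] with α hk hA
  simp only [Function.comp]
  have e3 : 1 / (J (e α) * (η - 1)) = g (e α) / (1 - α) * ((2 * α - 1) / (η - 1)) := by
    rw [← mul_div_assoc, hk]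
    rw [div_div]
  rw [e3]
  rw [div_mul_div_cancel₀ hA]
  simp only [hg, hF, hq]
end

section
/- Let L be an integrable real random variable with E[L] = 0 and P[L > 0] > 0 whose distribution function F has finite right endpoint x̂ = sup{x : F(x) < 1} < ∞, and suppose the function t ↦ 1 − F(x̂ − 1/t) is of second-order regular variation 2RV_{−η,ρ} with η > 0 and ρ < 0. Then, with β* = P[L ≤ e_α(L)] and q_α = q_L(α), it holds that (1−β*)/(1−α) ∼ ( x̂(η+1)/(x̂ − q_α) )^{η/(η+1)} as α ↗ 1, i.e. the ratio of the two sides converges to 1. -/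
open MeasureTheory Filter Topology Real Set
open scoped ENNReal

lemma aux_log_quot (g : ℝ → ℝ) (hg : ∀ t, 0 < t → 0 < g t) (η ρ : ℝ) (hρ : ρ < 0) (A : ℝ → ℝ)
    (h : SecondOrderRV g η ρ A) (x : ℝ) (hx : 0 < x) :
    Tendsto (fun t => ((log (g (t * x)) + η * log (t * x)) - (log (g t) + η * log t)) / A t) atTop
      (𝓝 ((x ^ ρ - 1) / ρ)) := by
  obtain ⟨h1, -, -, h2⟩ := h
  have hR : Tendsto (fun t => g (t * x) / g t * x ^ η) atTop (𝓝 1) := by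
    have := (h1 x hx).mul_const (x ^ η)
    rwa [← rpow_add hx, neg_add_cancel, rpow_zero] at this
  have hd : Tendsto (fun t => dslope log 1 (g (t * x) / g t * x ^ η)) atTop (𝓝 1) := by
    have hc : ContinuousAt (dslope log 1) 1 :=
      continuousAt_dslope_same.2 (Real.differentiableAt_log one_ne_zero)
    have := hc.tendsto.comp hR
    simpa [dslope_same, Function.comp_def] using this
  have h3 := ((h2 x hx).mul_const (x ^ η)).mul hd
  rw [if_neg hρ.ne] at h3
  have e1 : x ^ (-η) * (x ^ ρ - 1) / ρ * x ^ η * 1 = (x ^ ρ - 1) / ρ := by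
    have : x ^ (-η) * x ^ η = 1 := by rw [← rpow_add hx, neg_add_cancel, rpow_zero]
    calc _ = (x ^ (-η) * x ^ η) * ((x ^ ρ - 1) / ρ) := by ring
      _ = _ := by rw [this, one_mul]
  rw [e1] at h3
  refine h3.congr' ?_
  filter_upwards [eventually_gt_atTop 0] with t ht
  have p1 := hg t ht
  have p2 := hg (t * x) (by positivity)
  have e2 := sub_smul_dslope log 1 (g (t * x) / g t * x ^ η)
  rw [log_one, sub_zero, log_mul (by positivity) (by positivity), log_div p2.ne' p1.ne',
    log_rpow hx, smul_eq_mul] at e2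
  rw [log_mul ht.ne' hx.ne']
  have e3 : x ^ (-η) * x ^ η = 1 := by rw [← rpow_add hx, neg_add_cancel, rpow_zero]
  have : (g (t * x) / g t - x ^ (-η)) / A t * x ^ η * dslope log 1 (g (t * x) / g t * x ^ η)
     = ((g (t * x) / g t * x ^ η - 1) * dslope log 1 (g (t * x) / g t * x ^ η)) / A t := by
    rw [← e3]; ring
  rw [this, e2]; ring

lemma aux_conv (V A : ℝ → ℝ) (ρ : ℝ) (hρ : ρ < 0) (hA : Tendsto A atTop (𝓝 0))
    (hA0 : ∀ᶠ t in atTop, A t ≠ 0)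
    (h : ∀ x : ℝ, 0 < x → Tendsto (fun t => (V (t * x) - V t) / A t) atTop (𝓝 ((x ^ ρ - 1) / ρ))) :
    ∃ v, Tendsto V atTop (𝓝 v) := by
  have hz : ∀ x : ℝ, 0 < x → Tendsto (fun t => V (t * x) - V t) atTop (𝓝 0) := by
    intro x hx
    have := (h x hx).mul hA
    rw [mul_zero] at this
    refine this.congr' ?_
    filter_upwards [hA0] with t ht
    field_simp
  have h2 := h 2 two_pos
  have h4 := h 4 four_pos
  have hr1 : (2:ℝ) ^ ρ < 1 := rpow_lt_one_of_one_lt_of_neg one_lt_two hρ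
  have hr0 : 0 < (2:ℝ) ^ ρ := by positivity
  have hC : ((2:ℝ) ^ ρ - 1) / ρ ≠ 0 := div_ne_zero (by linarith) hρ.ne
  have h44 : (4:ℝ) ^ ρ = 2 ^ ρ * 2 ^ ρ := by
    rw [← mul_rpow (by norm_num) (by norm_num)]; norm_num
  have hq := (h4.sub h2).div h2 hC
  have e1 : (((4:ℝ) ^ ρ - 1) / ρ - (2 ^ ρ - 1) / ρ) / ((2 ^ ρ - 1) / ρ) = 2 ^ ρ := by
    have : (2:ℝ) ^ ρ - 1 ≠ 0 := by linarith
    have := hρ.ne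
    rw [h44]; field_simp; ring
  rw [e1] at hq
  set r := ((2:ℝ) ^ ρ + 1) / 2 with hr
  have hrlt : r < 1 := by rw [hr]; linarith
  have hrpos : 0 < r := by rw [hr]; linarith
  have hev : ∀ᶠ t in atTop, |V (t * 2 * 2) - V (t * 2)| ≤ r * |V (t * 2) - V t| := by
    have hlt : ∀ᶠ t in atTop, |((V (t * 4) - V t) / A t - (V (t * 2) - V t) / A t) /
        ((V (t * 2) - V t) / A t)| < r := by
      apply hq.abs.eventually_lt_const
      rw [abs_of_pos hr0, hr]; linarith
    filter_upwards [hlt, hA0, h2.eventually_ne hC] with t ht ha hne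
    have hD : V (t * 2) - V t ≠ 0 := fun h0 => hne (by rw [h0, zero_div])
    have e2 : ((V (t * 4) - V t) / A t - (V (t * 2) - V t) / A t) /
        ((V (t * 2) - V t) / A t) = (V (t * 4) - V (t * 2)) / (V (t * 2) - V t) := by
      field_simp; ring
    rw [e2, abs_div, div_lt_iff₀ (abs_pos.2 hD)] at ht
    rw [show t * 2 * 2 = t * 4 by ring]
    exact ht.le
  obtain ⟨T, hT⟩ := (hev.and (eventually_ge_atTop 1)).exists_forall_of_atTop
  have hT1 : 1 ≤ T := (hT T le_rfl).2
  have hgeo : ∀ t, T ≤ t → ∀ n : ℕ, dist (V (t * 2 ^ n)) (V (t * 2 ^ (n + 1)))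
      ≤ |V (t * 2) - V t| * r ^ n := by
    intro t ht n
    induction n with
    | zero => simp [Real.dist_eq, abs_sub_comm]
    | succ n ih =>
      have h5 : T ≤ t * 2 ^ n := by
        have : (1:ℝ) ≤ 2 ^ n := one_le_pow₀ (by norm_num)
        nlinarith
      have h6 := (hT _ h5).1
      rw [Real.dist_eq, abs_sub_comm] at ih ⊢
      rw [show t * 2 ^ (n + 1 + 1) = t * 2 ^ n * 2 * 2 by ring,
        show t * 2 ^ (n + 1) = t * 2 ^ n * 2 by ring] at *
      calc _ ≤ _ := h6
        _ ≤ r * (|V (t * 2) - V t| * r ^ n) := by gcongr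
        _ = _ := by ring
  have hpow : Tendsto (fun n : ℕ => T * (2:ℝ) ^ n) atTop atTop :=
    (tendsto_pow_atTop_atTop_of_one_lt one_lt_two).const_mul_atTop (by linarith)
  obtain ⟨v, hv⟩ := cauchySeq_tendsto_of_complete
    (cauchySeq_of_le_geometric r _ hrlt (hgeo T le_rfl))
  refine ⟨v, ?_⟩
  have hbd : ∀ t, T ≤ t → dist (V t) v ≤ |V (t * 2) - V t| / (1 - r) := by
    intro t ht
    have htend : Tendsto (fun n : ℕ => V (t * 2 ^ n)) atTop (𝓝 v) := by
      have := ((hz (t / T) (by apply div_pos <;> linarith)).comp hpow).add hv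
      rw [zero_add] at this
      refine this.congr fun n => ?_
      simp only [Function.comp]
      rw [show T * 2 ^ n * (t / T) = t * 2 ^ n by field_simp]
      ring
    have := dist_le_of_le_geometric_of_tendsto₀ r _ hrlt (hgeo t ht) htend
    simpa using this
  rw [tendsto_iff_dist_tendsto_zero]
  have hb := ((hz 2 two_pos).abs.div_const (1 - r))
  rw [abs_zero, zero_div] at hb
  refine squeeze_zero' (Eventually.of_forall fun _ => dist_nonneg) ?_ hb
  filter_upwards [eventually_ge_atTop T] with t ht using hbd t ht

lemma aux_const (g : ℝ → ℝ) (hg : ∀ t, 0 < t → 0 < g t) (η ρ : ℝ) (hρ : ρ < 0) (A : ℝ → ℝ)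
    (h : SecondOrderRV g η ρ A) :
    ∃ c, 0 < c ∧ Tendsto (fun t => g t * t ^ η) atTop (𝓝 c) := by
  have hA0 : ∀ᶠ t in atTop, A t ≠ 0 := by
    rcases h.2.2.1 with h | h
    · filter_upwards [h] with t ht using ht.ne'
    · filter_upwards [h] with t ht using ht.ne
  obtain ⟨v, hv⟩ := aux_conv (fun t => log (g t) + η * log t) A ρ hρ h.2.1 hA0
    (fun x hx => aux_log_quot g hg η ρ hρ A h x hx)
  refine ⟨exp v, exp_pos v, ?_⟩
  have := (Real.continuous_exp.tendsto v).comp hv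
  refine this.congr' ?_
  filter_upwards [eventually_gt_atTop 0] with t ht
  simp only [Function.comp]
  rw [exp_add, exp_log (hg t ht), rpow_def_of_pos ht, mul_comm η]

lemma aux_ae_le {Ω : Type*} [MeasurableSpace Ω] (P : Measure Ω)
    [IsProbabilityMeasure P] (L : Ω → ℝ) (hL : AEMeasurable L P)
    (xhat : ℝ) (hxhat : IsLUB {x : ℝ | (P {ω | L ω ≤ x}).toReal < 1} xhat) :
    ∀ᵐ ω ∂P, L ω ≤ xhat := by
  have h1 : ∀ n : ℕ, ∀ᵐ ω ∂P, L ω ≤ xhat + 1 / ((n : ℝ) + 1) := by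
    intro n
    have hp : (0:ℝ) < 1 / ((n : ℝ) + 1) := by positivity
    have h2 : ¬ ((P {ω | L ω ≤ xhat + 1 / ((n : ℝ) + 1)}).toReal < 1) := by
      intro h
      have := hxhat.1 h
      linarith
    have hm : NullMeasurableSet {ω | L ω ≤ xhat + 1 / ((n : ℝ) + 1)} P :=
      nullMeasurableSet_le hL aemeasurable_const
    have h3 : P {ω | L ω ≤ xhat + 1 / ((n : ℝ) + 1)} = 1 := by
      apply le_antisymm prob_le_one
      by_contra hlt
      push Not at hlt
      apply h2
      have := (ENNReal.toReal_lt_toReal (measure_ne_top _ _) ENNReal.one_ne_top).2 hlt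
      simpa using this
    exact (mem_ae_iff_prob_eq_one₀ hm).2 h3
  have h2 := ae_all_iff.2 h1
  filter_upwards [h2] with ω hω
  have ht : Tendsto (fun n : ℕ => xhat + 1 / ((n : ℝ) + 1)) atTop (𝓝 (xhat + 0)) :=
    tendsto_const_nhds.add tendsto_one_div_add_atTop_nhds_zero_nat
  rw [add_zero] at ht
  exact ge_of_tendsto' ht hω

lemma aux_karamata (H : ℝ → ℝ) (hH : Monotone H) (η c : ℝ) (hη : 0 < η)
    (h : Tendsto (fun s => H s / s ^ η) (𝓝[>] 0) (𝓝 c)) :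
    Tendsto (fun s => (∫ u in (0:ℝ)..s, H u) / s ^ (η + 1)) (𝓝[>] 0) (𝓝 (c / (η + 1))) := by
  rw [Metric.tendsto_nhds] at h ⊢
  intro ε hε
  have h1 := h ε hε
  rw [eventually_nhdsWithin_iff, Metric.eventually_nhds_iff] at h1
  obtain ⟨δ, hδ, h1⟩ := h1
  have hmem : Ioo (0:ℝ) δ ∈ 𝓝[>] (0:ℝ) := Ioo_mem_nhdsGT hδ
  filter_upwards [hmem] with s hs
  have hs0 := hs.1
  have hsp : 0 < s ^ (η + 1) := by positivity
  have hint : ∀ k : ℝ, ∫ u in (0:ℝ)..s, k * u ^ η = k * (s ^ (η + 1) / (η + 1)) := by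
    intro k
    rw [intervalIntegral.integral_const_mul, integral_rpow (Or.inl (by linarith)),
      zero_rpow (by linarith), sub_zero]
  have hii : ∀ k : ℝ, IntervalIntegrable (fun u : ℝ => k * u ^ η) volume 0 s := fun k =>
    (intervalIntegral.intervalIntegrable_rpow' (by linarith)).const_mul k
  have h2 : ‖∫ u in (0:ℝ)..s, (H u - c * u ^ η)‖ ≤ ∫ u in (0:ℝ)..s, ε * u ^ η := by
    apply intervalIntegral.norm_integral_le_of_norm_le hs0.le _ (hii ε)
    refine ae_of_all _ fun u hu => ?_
    have hu0 : 0 < u := hu.1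
    have hup : 0 < u ^ η := by positivity
    have := h1 (y := u) (by rw [Real.dist_eq, sub_zero, abs_of_pos hu0]; exact hu.2.trans_lt hs.2) hu0
    rw [Real.dist_eq] at this
    have e1 : H u - c * u ^ η = (H u / u ^ η - c) * u ^ η := by field_simp
    rw [e1, norm_mul, Real.norm_eq_abs, Real.norm_eq_abs, abs_of_pos hup]
    gcongr
  rw [intervalIntegral.integral_sub hH.intervalIntegrable (hii c), hint, hint, Real.norm_eq_abs] at h2
  rw [Real.dist_eq]
  have e2 : (∫ u in (0:ℝ)..s, H u) / s ^ (η + 1) - c / (η + 1)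
    = ((∫ u in (0:ℝ)..s, H u) - c * (s ^ (η + 1) / (η + 1))) / s ^ (η + 1) := by
    field_simp
  rw [e2, abs_div, abs_of_pos hsp, div_lt_iff₀ hsp]
  refine h2.trans_lt ?_
  have : s ^ (η + 1) / (η + 1) < s ^ (η + 1) := div_lt_self hsp (by linarith)
  gcongr

lemma aux_layer {Ω : Type*} [MeasurableSpace Ω] (P : Measure Ω)
    [IsProbabilityMeasure P] (L : Ω → ℝ) (hL : Integrable L P)
    (xhat : ℝ) (hae : ∀ᵐ ω ∂P, L ω ≤ xhat) (s : ℝ) (hs : 0 < s) :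
    ∫ ω, max (L ω - (xhat - s)) 0 ∂P
      = ∫ u in (0:ℝ)..s, (1 - (P {ω | L ω ≤ xhat - u}).toReal) := by
  have hi : Integrable (fun ω => max (L ω - (xhat - s)) 0) P :=
    (hL.sub (integrable_const _)).pos_part
  rw [hi.integral_eq_integral_meas_lt (ae_of_all _ fun ω => le_max_right _ _)]
  have hm : ∀ m : ℝ, P.real {ω | m < L ω} = 1 - (P {ω | L ω ≤ m}).toReal := by
    intro m
    have hn : NullMeasurableSet {ω | L ω ≤ m} P :=
      nullMeasurableSet_le hL.aemeasurable aemeasurable_const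
    have := probReal_compl_eq_one_sub₀ hn
    rw [← measureReal_def, ← this]
    congr 1
    ext ω; simp
  have h1 : ∀ t ∈ Ioi (0:ℝ), P.real {ω | t < max (L ω - (xhat - s)) 0}
      = (Ioc (0:ℝ) s).indicator (fun t => 1 - (P {ω | L ω ≤ xhat - (s - t)}).toReal) t := by
    intro t ht
    have ht0 : 0 < t := ht
    have e1 : {ω | t < max (L ω - (xhat - s)) 0} = {ω | xhat - (s - t) < L ω} := by
      ext ω
      simp only [mem_ofPred_eq, lt_max_iff, not_lt.2 ht0.le, or_false]
      constructor <;> intro h <;> linarith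
    rw [e1]
    by_cases hts : t ≤ s
    · rw [indicator_of_mem (show t ∈ Ioc 0 s from ⟨ht0, hts⟩), hm]
    · rw [indicator_of_notMem (fun h => hts h.2)]
      push Not at hts
      rw [measureReal_eq_zero_iff]
      have : ∀ᵐ ω ∂P, ¬ (xhat - (s - t) < L ω) := by
        filter_upwards [hae] with ω hω
        linarith
      simpa [ae_iff] using this
  rw [setIntegral_congr_fun measurableSet_Ioi h1, setIntegral_indicator measurableSet_Ioc]
  have e2 : Ioi (0:ℝ) ∩ Ioc 0 s = Ioc 0 s := by
    ext t; simp
  rw [e2, ← intervalIntegral.integral_of_le hs.le]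
  have := intervalIntegral.integral_comp_sub_left (a := 0) (b := s)
    (fun u => 1 - (P {ω | L ω ≤ xhat - u}).toReal) s
  rw [this]; simp

lemma aux_quantile (F : ℝ → ℝ) (hF : Monotone F) (xhat η c : ℝ)
    (hlt : ∀ m, m < xhat → F m < 1) (hη : 0 < η)
    (h : Tendsto (fun s => (1 - F (xhat - s)) / s ^ η) (𝓝[>] 0) (𝓝 c)) :
    (∀ᶠ α in 𝓝[<] (1:ℝ), 0 < xhat - sInf {m : ℝ | α ≤ F m}) ∧
    Tendsto (fun α => (1 - α) / (xhat - sInf {m : ℝ | α ≤ F m}) ^ η) (𝓝[<] (1:ℝ)) (𝓝 c) := by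
  have hid : Tendsto (fun s : ℝ => s) (𝓝[>] 0) (𝓝 0) := tendsto_id.mono_left nhdsWithin_le_nhds
  have hH0 : Tendsto (fun s => 1 - F (xhat - s)) (𝓝[>] 0) (𝓝 0) := by
    have h1 : Tendsto (fun s : ℝ => s ^ η) (𝓝[>] 0) (𝓝 0) := by
      have := hid.rpow_const (p := η) (Or.inr hη.le)
      rwa [zero_rpow hη.ne'] at this
    have := h.mul h1
    rw [mul_zero] at this
    refine this.congr' ?_
    filter_upwards [self_mem_nhdsWithin] with s hs
    have : (0:ℝ) < s := hs
    field_simp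
  have hne : ∀ α, α < 1 → ∃ s, 0 < s ∧ α ≤ F (xhat - s) := by
    intro α hα
    have h1 := hH0.eventually_lt_const (show (0:ℝ) < 1 - α by linarith)
    obtain ⟨s, h2, h3⟩ := (h1.and self_mem_nhdsWithin).exists
    exact ⟨s, h3, by linarith⟩
  have hbd : ∀ s, ∀ α, F (xhat - s) < α → xhat - s ∈ lowerBounds {m : ℝ | α ≤ F m} := by
    intro s α hα m hm
    by_contra hlt
    push Not at hlt
    have h1 := hF hlt.le
    have h2 : α ≤ F m := hm
    linarith
  have hpos : ∀ α, F (xhat - 1) < α → α < 1 → 0 < xhat - sInf {m : ℝ | α ≤ F m} := by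
    intro α h1 h2
    obtain ⟨s, hs, hs2⟩ := hne α h2
    have := csInf_le ⟨_, hbd 1 α h1⟩ (show xhat - s ∈ {m : ℝ | α ≤ F m} from hs2)
    linarith
  have hev : ∀ s, 0 < s → ∀ᶠ α in 𝓝[<] (1:ℝ), F (xhat - s) < α ∧ α < 1 := fun s hs =>
    Ioo_mem_nhdsLT (hlt _ (by linarith))
  have hd0 : Tendsto (fun α => xhat - sInf {m : ℝ | α ≤ F m}) (𝓝[<] (1:ℝ)) (𝓝[>] 0) := by
    rw [tendsto_nhdsWithin_iff]
    refine ⟨?_, ?_⟩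
    · rw [Metric.tendsto_nhds]
      intro ε hε
      filter_upwards [hev 1 one_pos, hev (ε / 2) (by linarith)] with α h1 h2
      have p := hpos α h1.1 h1.2
      obtain ⟨s, hs, hs2⟩ := hne α h1.2
      have := le_csInf (s := {m : ℝ | α ≤ F m}) ⟨xhat - s, hs2⟩ (hbd (ε / 2) α h2.1)
      rw [Real.dist_eq, sub_zero, abs_of_pos p]
      linarith
    · filter_upwards [hev 1 one_pos] with α h1 using hpos α h1.1 h1.2
  refine ⟨?_, ?_⟩
  · filter_upwards [hev 1 one_pos] with α h1 using hpos α h1.1 h1.2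
  have key : ∀ σ : ℝ, Tendsto (fun d : ℝ => (1 - F (xhat - d * (1 + σ * d))) / d ^ η)
      (𝓝[>] 0) (𝓝 c) := by
    intro σ
    have h1 : Tendsto (fun d : ℝ => 1 + σ * d) (𝓝[>] 0) (𝓝 1) := by
      have := (hid.const_mul σ).const_add 1
      simpa using this
    have hp : ∀ᶠ d in 𝓝[>] (0:ℝ), 0 < 1 + σ * d := h1.eventually_const_lt one_pos
    have h2 : Tendsto (fun d : ℝ => d * (1 + σ * d)) (𝓝[>] 0) (𝓝[>] 0) := by
      rw [tendsto_nhdsWithin_iff]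
      refine ⟨by simpa using hid.mul h1, ?_⟩
      filter_upwards [hp, self_mem_nhdsWithin] with d hd hd2
      exact mul_pos hd2 hd
    have h3 := (h.comp h2).mul (h1.rpow_const (p := η) (Or.inl one_ne_zero))
    rw [one_rpow, mul_one] at h3
    refine h3.congr' ?_
    filter_upwards [hp, self_mem_nhdsWithin] with d hd hd2
    have hd3 : (0:ℝ) < d := hd2
    simp only [Function.comp]
    rw [mul_rpow hd3.le hd.le]
    have hp1 : 0 < (1 + σ * d) ^ η := by positivity
    rw [← div_div, div_mul_cancel₀ _ hp1.ne']
  refine tendsto_of_tendsto_of_tendsto_of_le_of_le' ((key (-1)).comp hd0) ((key 1).comp hd0) ?_ ?_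
  · filter_upwards [hev 1 one_pos] with α h1
    have p := hpos α h1.1 h1.2
    simp only [Function.comp]
    obtain ⟨s, hs, hs2⟩ := hne α h1.2
    set q := sInf {m : ℝ | α ≤ F m} with hq
    gcongr
    have : q < xhat - (xhat - q) * (1 + -1 * (xhat - q)) := by nlinarith
    obtain ⟨m, hm, hm2⟩ := exists_lt_of_csInf_lt (s := {m : ℝ | α ≤ F m}) ⟨xhat - s, hs2⟩ this
    exact le_trans hm (hF hm2.le)
  · filter_upwards [hev 1 one_pos] with α h1
    have p := hpos α h1.1 h1.2
    simp only [Function.comp]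
    set q := sInf {m : ℝ | α ≤ F m} with hq
    gcongr
    have : xhat - (xhat - q) * (1 + 1 * (xhat - q)) < q := by nlinarith
    have := notMem_of_lt_csInf this ⟨_, hbd 1 α h1.1⟩
    exact (not_le.1 this).le

lemma aux_final (η M c : ℝ) (hη : 0 < η) (hM : 0 < M) (hc : 0 < c) (l : Filter ℝ)
    (a s d h : ℝ → ℝ) (ha : ∀ᶠ x in l, 0 < a x) (hs : ∀ᶠ x in l, 0 < s x)
    (hd : ∀ᶠ x in l, 0 < d x)
    (h1 : Tendsto (fun x => h x / s x ^ η) l (𝓝 c))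
    (h2 : Tendsto (fun x => a x / d x ^ η) l (𝓝 c))
    (h3 : Tendsto (fun x => a x / s x ^ (η + 1)) l (𝓝 (c / M))) :
    Tendsto (fun x => (h x / a x) / ((M / d x) ^ (η / (η + 1)))) l (𝓝 1) := by
  have hη1 : 0 < η + 1 := by linarith
  have hcM : 0 < c / M := by positivity
  have h4 := ((h1.mul (h3.rpow_const (p := -(η / (η + 1))) (Or.inl hcM.ne'))).mul
    (h2.rpow_const (p := -(1 / (η + 1))) (Or.inl hc.ne'))).mul_const (M ^ (-(η / (η + 1))))
  have e1 : c * (c / M) ^ (-(η / (η + 1))) * c ^ (-(1 / (η + 1))) * M ^ (-(η / (η + 1))) = 1 := by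
    apply Real.log_injOn_pos (mem_Ioi.2 (by positivity)) (mem_Ioi.2 one_pos)
    rw [log_mul (by positivity) (by positivity), log_mul (by positivity) (by positivity),
      log_mul (by positivity) (by positivity), log_rpow hcM, log_rpow hc, log_rpow hM,
      log_div hc.ne' hM.ne', log_one]
    field_simp
    ring
  rw [e1] at h4
  refine h4.congr' ?_
  filter_upwards [ha, hs, hd, h1.eventually_const_lt hc] with x ha hs hd hh
  have hsp : 0 < s x ^ η := by positivity
  have hsp1 : 0 < s x ^ (η + 1) := by positivity
  have hdp : 0 < d x ^ η := by positivity
  have hh : 0 < h x := by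
    have := mul_pos hh hsp
    rwa [div_mul_cancel₀ _ hsp.ne'] at this
  apply Real.log_injOn_pos (mem_Ioi.2 (by positivity)) (mem_Ioi.2 (by positivity))
  rw [log_mul (by positivity) (by positivity), log_mul (by positivity) (by positivity),
      log_mul (by positivity) (by positivity), log_rpow (by positivity), log_rpow (by positivity),
      log_rpow hM, log_div (by positivity) (by positivity), log_div (by positivity) (by positivity),
      log_div (by positivity) (by positivity), log_div (by positivity) (by positivity),
      log_div (by positivity) (by positivity), log_rpow hs, log_rpow hs, log_rpow hd,
      log_rpow (by positivity), log_div (by positivity) (by positivity)]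
  field_simp
  ring

/-- for centered `L` with `P[L > 0] > 0`, finite right endpoint `x̂` and
`t ↦ 1-F(x̂-1/t) ∈ 2RV_{-η,ρ}` with `η > 0`, `ρ < 0`, one has, as `α ↗ 1`,
`(1-β*)/(1-α) ∼ (x̂(η+1)/(x̂-q_α))^{η/(η+1)}`, where `β* = P[L ≤ e_α(L)]`. -/
theorem weibull_second_order_beta {Ω : Type*} [MeasurableSpace Ω] (P : Measure Ω)
    [IsProbabilityMeasure P] (L : Ω → ℝ) (hL : Integrable L P)
    (hmean : (∫ ω, L ω ∂P) = 0) (hpos : 0 < (P {ω | 0 < L ω}).toReal)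
    (xhat : ℝ) (hxhat : IsLUB {x : ℝ | (P {ω | L ω ≤ x}).toReal < 1} xhat)
    (η ρ : ℝ) (hη : 0 < η) (hρ : ρ < 0) (A : ℝ → ℝ)
    (hrv2 : SecondOrderRV (fun t => 1 - (P {ω | L ω ≤ xhat - 1 / t}).toReal) η ρ A)
    (e : ℝ → ℝ) (he : ∀ α : ℝ, 1 / 2 ≤ α → α < 1 → IsExpectile P L α (e α)) :
    Tendsto (fun α =>
        ((1 - (P {ω | L ω ≤ e α}).toReal) / (1 - α)) /
          ((xhat * (η + 1) / (xhat - leftQuantile P L α)) ^ (η / (η + 1))))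
      (𝓝[<] (1 : ℝ)) (𝓝 1) := by
  set F : ℝ → ℝ := fun m => (P {ω | L ω ≤ m}).toReal with hFdef
  have hF : Monotone F := by
    intro a b hab
    exact ENNReal.toReal_mono (measure_ne_top _ _)
      (measure_mono fun ω (h : L ω ≤ a) => h.trans hab)
  have hlt : ∀ m, m < xhat → F m < 1 := by
    intro m hm
    obtain ⟨x, hx, hmx, -⟩ := hxhat.exists_between hm
    exact lt_of_le_of_lt (hF hmx.le) hx
  have hae := aux_ae_le P L hL.aemeasurable xhat hxhat
  have hxpos : 0 < xhat := by
    by_contra hn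
    have : P {ω | 0 < L ω} = 0 := by
      have : ∀ᵐ ω ∂P, ¬ (0 < L ω) := by
        filter_upwards [hae] with ω hω
        linarith
      simpa [ae_iff] using this
    rw [this] at hpos
    simp at hpos
  obtain ⟨c, hc, hgc⟩ := aux_const _ (fun t ht => by
    have : 0 < 1 / t := by positivity
    have := hlt (xhat - 1 / t) (by linarith)
    simp only [hFdef] at this
    linarith) η ρ hρ A hrv2
  have hK : Tendsto (fun s => (1 - F (xhat - s)) / s ^ η) (𝓝[>] 0) (𝓝 c) := by
    refine (hgc.comp tendsto_inv_nhdsGT_zero).congr' ?_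
    filter_upwards [self_mem_nhdsWithin] with s hs
    have hs0 : (0:ℝ) < s := hs
    simp only [Function.comp, one_div, inv_inv, hFdef]
    rw [inv_rpow hs0.le, div_eq_mul_inv]
  have hJ : Tendsto (fun s => (∫ ω, max (L ω - (xhat - s)) 0 ∂P) / s ^ (η + 1)) (𝓝[>] 0)
      (𝓝 (c / (η + 1))) := by
    refine (aux_karamata (fun s => 1 - F (xhat - s)) ?_ η c hη hK).congr' ?_
    · intro a b hab
      have := hF (show xhat - b ≤ xhat - a by linarith)
      simp only
      linarith
    · filter_upwards [self_mem_nhdsWithin] with s hs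
      rw [aux_layer P L hL xhat hae s hs]
  have hii : ∀ m, Integrable (fun ω => max (L ω - m) 0) P := fun m =>
    (hL.sub (integrable_const _)).pos_part
  have hJpos : ∀ m, m < xhat → 0 < ∫ ω, max (L ω - m) 0 ∂P := by
    intro m hm
    have h1 := hJ.eventually_const_lt (show 0 < c / (η + 1) by positivity)
    have h2 : Ioo (0:ℝ) (xhat - m) ∈ 𝓝[>] (0:ℝ) := Ioo_mem_nhdsGT (by linarith)
    obtain ⟨s, h1, h2⟩ := (h1.and h2).exists
    have hs : 0 < s ^ (η + 1) := by have := h2.1; positivity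
    have h3 : 0 < ∫ ω, max (L ω - (xhat - s)) 0 ∂P := by
      have := mul_pos h1 hs
      rwa [div_mul_cancel₀ _ hs.ne'] at this
    refine h3.trans_le (integral_mono (hii _) (hii _) fun ω => ?_)
    have := h2.2
    exact max_le_max (by linarith) le_rfl
  -- the expectile equation
  have hexp : ∀ α, 1 / 2 ≤ α → α < 1 →
      (2 * α - 1) * ∫ ω, max (L ω - e α) 0 ∂P = (1 - α) * e α := by
    intro α h1 h2
    have h3 := he α h1 h2
    unfold IsExpectile at h3
    have h4 : ∫ ω, max (e α - L ω) 0 ∂P = (∫ ω, max (L ω - e α) 0 ∂P) + e α := by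
      have h5 : ∀ ω, max (e α - L ω) 0 = max (L ω - e α) 0 - (L ω - e α) := by
        intro ω
        rcases le_total (L ω) (e α) with h | h
        · rw [max_eq_left (by linarith), max_eq_right (by linarith)]; ring
        · rw [max_eq_right (by linarith), max_eq_left (by linarith)]; ring
      simp_rw [h5]
      rw [integral_sub (hii _) (show Integrable (fun ω => L ω - e α) P from hL.sub (integrable_const _)),
        integral_sub hL (integrable_const _), hmean]
      simp
    rw [h4] at h3
    linarith
  have hJnn : ∀ m, 0 ≤ ∫ ω, max (L ω - m) 0 ∂P := fun m =>
    integral_nonneg fun ω => le_max_right _ _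
  have helt : ∀ α, 1 / 2 < α → α < 1 → e α < xhat := by
    intro α h1 h2
    by_contra hn
    push Not at hn
    have h3 := hexp α h1.le h2
    have h4 : ∫ ω, max (L ω - e α) 0 ∂P = 0 := by
      rw [integral_eq_zero_of_ae]
      filter_upwards [hae] with ω hω
      exact max_eq_right (by linarith)
    rw [h4, mul_zero] at h3
    have : 0 < (1 - α) * e α := mul_pos (by linarith) (by linarith)
    linarith
  have hev : ∀ᶠ α in 𝓝[<] (1:ℝ), 1 / 2 < α ∧ α < 1 := Ioo_mem_nhdsLT (by norm_num)
  have hid : Tendsto (fun α : ℝ => α) (𝓝[<] 1) (𝓝 1) := tendsto_id.mono_left nhdsWithin_le_nhds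
  have h2a : Tendsto (fun α : ℝ => 2 * α - 1) (𝓝[<] 1) (𝓝 1) := by
    have := (hid.const_mul 2).sub_const 1
    norm_num at this
    exact this
  have hsm : Tendsto (fun α : ℝ => (1 - α) * xhat / (2 * α - 1)) (𝓝[<] 1) (𝓝 0) := by
    have := ((hid.const_sub 1).mul_const xhat).div h2a one_ne_zero
    rw [sub_self, zero_mul, zero_div] at this
    exact this
  have hs0 : Tendsto (fun α => xhat - e α) (𝓝[<] (1:ℝ)) (𝓝[>] 0) := by
    rw [tendsto_nhdsWithin_iff]
    refine ⟨?_, ?_⟩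
    · rw [Metric.tendsto_nhds]
      intro ε hε
      have hJε := hJpos (xhat - ε) (by linarith)
      filter_upwards [hev, hsm.eventually_lt_const hJε] with α h1 h2
      have h3 := helt α h1.1 h1.2
      rw [Real.dist_eq, sub_zero, abs_of_pos (by linarith)]
      by_contra hn
      push Not at hn
      have h4 : ∫ ω, max (L ω - (xhat - ε)) 0 ∂P ≤ ∫ ω, max (L ω - e α) 0 ∂P :=
        integral_mono (hii _) (hii _) fun ω => max_le_max (by linarith) le_rfl
      have h5 := hexp α h1.1.le h1.2
      have h6 : 0 < 2 * α - 1 := by linarith [h1.1]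
      rw [div_lt_iff₀ h6] at h2
      have h7 : (1 - α) * e α ≤ (1 - α) * xhat :=
        mul_le_mul_of_nonneg_left h3.le (by linarith [h1.2])
      nlinarith
    · filter_upwards [hev] with α h1
      have := helt α h1.1 h1.2
      simp only [mem_Ioi]
      linarith
  have hspos : ∀ᶠ α in 𝓝[<] (1:ℝ), 0 < xhat - e α := by
    filter_upwards [hev] with α h1
    have := helt α h1.1 h1.2
    linarith
  have het : Tendsto e (𝓝[<] (1:ℝ)) (𝓝 xhat) := by
    have := (hs0.mono_right nhdsWithin_le_nhds).const_sub xhat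
    simpa using this
  have h3 : Tendsto (fun α => (1 - α) / (xhat - e α) ^ (η + 1)) (𝓝[<] (1:ℝ))
      (𝓝 (c / (xhat * (η + 1)))) := by
    have := ((hJ.comp hs0).mul h2a).div het hxpos.ne'
    have e1 : c / (η + 1) * 1 / xhat = c / (xhat * (η + 1)) := by
      field_simp
    rw [e1] at this
    refine this.congr' ?_
    filter_upwards [hev, het.eventually_const_lt hxpos] with α h1 h2
    have h4 := hexp α h1.1.le h1.2
    simp only [Pi.div_apply, Function.comp, sub_sub_cancel]
    rw [div_mul_eq_mul_div, mul_comm _ (2 * α - 1), h4]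
    field_simp
  obtain ⟨hq1, hq2⟩ := aux_quantile F hF xhat η c hlt hη hK
  have h1 : Tendsto (fun α => (1 - F (e α)) / (xhat - e α) ^ η) (𝓝[<] (1:ℝ)) (𝓝 c) := by
    refine (hK.comp hs0).congr fun α => ?_
    simp only [Function.comp, sub_sub_cancel]
  exact aux_final η (xhat * (η + 1)) c hη (by positivity) hc _ (fun α => 1 - α)
    (fun α => xhat - e α) (fun α => xhat - leftQuantile P L α) (fun α => 1 - F (e α))
    (by filter_upwards [hev] with α h1; linarith [h1.2]) hspos hq1 h1 hq2 h3
end
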